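/- arXiv:1102.2660 — 2 statements merged into one kernel-verified Lean document; each statement's English description precedes it below -/
import Mathlib

section
/- Let N be a compact topological n-manifold without boundary admitting a homotopy equivalence to the n-torus T^n = ℝ^n/ℤ^n, and let σ : N → N be an involution. If there is a fixed point of σ that is isolated in the fixed-point set {x ∈ N | σ(x) = x}, then σ is H_1-negative. -/
/-- A (boundaryless) topological `n`-manifold structure: every point has an open
neighborhood homeomorphic to an open subset of `ℝⁿ`. -/
def LocallyEuclidean (n : ℕ) (N : Type) [TopologicalSpace N] : Prop :=
  ∀ x : N, ∃ (U : Set N) (V : Set (Fin n → ℝ)),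
    IsOpen U ∧ x ∈ U ∧ IsOpen V ∧ Nonempty (U ≃ₜ V)

/-- The `n`-torus `Tⁿ = ℝⁿ/ℤⁿ = (ℝ/ℤ)ⁿ`. -/
abbrev Torus (n : ℕ) := Fin n → AddCircle (1 : ℝ)

/-- An involution `σ` is `H₁`-negative if for every basepoint `x`, every loop
`γ` at `x` and every path `q` from `σ x` to `x`, the transport of `σ ∘ γ` back
to the basepoint `x` along `q` is (path-)homotopic to the reverse loop `γ⁻¹`;
i.e. `σ` induces `-1` on `π₁` (equivalently on `H₁`) at every basepoint. -/
def H1Negative {N : Type} [TopologicalSpace N] (σ : N → N) (hσ : Continuous σ) : Prop :=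
  ∀ (x : N) (γ : Path x x) (q : Path (σ x) x),
    (q.symm.trans ((γ.map hσ).trans q)).Homotopic γ.symm

/-- The coboundary of a mod 2 cochain, cochains being functions on lists of points. -/
def coboundary {X : Type*} : (List X → ZMod 2) → List X → ZMod 2
  | _, [] => 0
  | κ, x :: l => κ l + coboundary (fun l' => κ (x :: l')) l

/-- The prism operator between two maps. -/
def prism {X : Type*} (f g : X → X) : (List X → ZMod 2) → List X → ZMod 2
  | _, [] => 0
  | κ, x :: l => κ (f x :: g x :: l.map g) + prism f g (fun l' => κ (f x :: l')) l

section Cochain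

open Set Filter Topology Uniformity unitInterval

variable {X : Type*}

lemma coboundary_congr {l : List X} {κ κ' : List X → ZMod 2}
    (h : ∀ l', l'.Sublist l → l'.length + 1 = l.length → κ l' = κ' l') :
    coboundary κ l = coboundary κ' l := by
  induction l generalizing κ κ' with
  | nil => rfl
  | cons x l ih =>
    simp only [coboundary]
    rw [h l (List.sublist_cons_self x l) rfl,
      ih fun l' hl hlen => h (x :: l') (hl.cons_cons x) (by simpa using hlen)]

lemma coboundary_zero (l : List X) : coboundary (fun _ => 0) l = 0 := by
  induction l with
  | nil => rfl
  | cons x l ih => simpa [coboundary] using ih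

lemma coboundary_add (κ κ' : List X → ZMod 2) (l : List X) :
    coboundary (fun l => κ l + κ' l) l = coboundary κ l + coboundary κ' l := by
  induction l generalizing κ κ' with
  | nil => simp [coboundary]
  | cons x l ih => simp only [coboundary, ih]; ring

lemma coboundary_const_mul (c : ZMod 2) (κ : List X → ZMod 2) (l : List X) :
    coboundary (fun l => c * κ l) l = c * coboundary κ l := by
  induction l generalizing κ with
  | nil => simp [coboundary]
  | cons x l ih => simp only [coboundary, ih]; ring

lemma coboundary_comp_map (g : X → X) (κ : List X → ZMod 2) (l : List X) :
    coboundary (fun l => κ (l.map g)) l = coboundary κ (l.map g) := by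
  induction l generalizing κ with
  | nil => rfl
  | cons x l ih =>
    simp only [coboundary, List.map_cons]
    rw [ih fun l => κ (g x :: l)]

lemma prism_add (f g : X → X) (κ κ' : List X → ZMod 2) (l : List X) :
    prism f g (fun l => κ l + κ' l) l = prism f g κ l + prism f g κ' l := by
  induction l generalizing κ κ' with
  | nil => simp [prism]
  | cons x l ih => simp only [prism, ih]; ring

/-- The prism operator is a cochain homotopy between the pullbacks along `f` and `g`. -/
lemma coboundary_prism (f g : X → X) (κ : List X → ZMod 2) (l : List X) :
    coboundary (prism f g κ) l + prism f g (coboundary κ) l =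
      κ (l.map f) + κ (l.map g) := by
  induction l generalizing κ with
  | nil => simp [coboundary, prism, CharTwo.add_self_eq_zero]
  | cons x l ih =>
    have key := ih fun l => κ (f x :: l)
    have nat := coboundary_comp_map g (fun l => κ (f x :: g x :: l)) l
    simp only [coboundary, prism, List.map_cons, coboundary_add, prism_add] at key nat ⊢
    rw [nat]
    generalize coboundary (fun l => κ (f x :: g x :: l)) (l.map g) = A at *
    linear_combination key +
      (prism f g κ l + A + κ (f x :: l.map g)) * (CharTwo.two_eq_zero (R := ZMod 2))

lemma prism_eq_zero {f g : X → X} {κ : List X → ZMod 2} {l : List X}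
    (h : ∀ l', l'.length = l.length + 1 → (∀ z ∈ l', ∃ x ∈ l, z = f x ∨ z = g x) → κ l' = 0) :
    prism f g κ l = 0 := by
  induction l generalizing κ with
  | nil => rfl
  | cons x l ih =>
    rw [prism, h, ih, add_zero]
    · intro l' hlen hl'
      refine h _ (by simpa using hlen) ?_
      simp only [List.mem_cons, forall_eq_or_imp, exists_eq_or_imp, true_or, true_and]
      exact fun z hz => .inr (hl' z hz)
    · simp
    · simp only [List.mem_cons, List.mem_map]
      rintro z (rfl | rfl | ⟨y, hy, rfl⟩)
      exacts [⟨x, by simp⟩, ⟨x, by simp⟩, ⟨y, by simp [hy]⟩]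

lemma exists_coboundary_eq_of_steps {l₀ : List X → Prop} {κ : List X → ZMod 2} (f : ℕ → X → X)
    (hf : ∀ i l, l₀ l → prism (f i) (f (i + 1)) (coboundary κ) l = 0) (M : ℕ) :
    ∃ μ : List X → ZMod 2, ∀ l, l₀ l →
      coboundary μ l = κ (l.map (f 0)) + κ (l.map (f M)) := by
  induction M with
  | zero => exact ⟨fun _ => 0, fun l _ => by rw [coboundary_zero, CharTwo.add_self_eq_zero]⟩
  | succ M ih =>
    obtain ⟨μ, hμ⟩ := ih
    refine ⟨fun l => μ l + prism (f M) (f (M + 1)) κ l, fun l hl => ?_⟩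
    have := coboundary_prism (f M) (f (M + 1)) κ l
    rw [hf M l hl] at this
    rw [coboundary_add, hμ l hl]
    linear_combination this + κ (l.map (f M)) * (CharTwo.two_eq_zero (R := ZMod 2))

variable [UniformSpace X]

/-- `κ` vanishes on all sufficiently small lists of `m` points of `K`. -/
def VanishesOn (K : Set X) (m : ℕ) (κ : List X → ZMod 2) : Prop :=
  ∃ V ∈ 𝓤 X, ∀ l : List X, l.length = m → (∀ x ∈ l, x ∈ K) →
    (∀ x ∈ l, ∀ y ∈ l, (x, y) ∈ V) → κ l = 0

lemma VanishesOn.comp_map {K K' : Set X} (hK : IsCompact K) {f : X → X} (hf : Continuous f)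
    (hKK' : MapsTo f K K') {m : ℕ} {κ : List X → ZMod 2} (h : VanishesOn K' m κ) :
    VanishesOn K m fun l => κ (l.map f) := by
  obtain ⟨V, hV, h⟩ := h
  have huc := hK.uniformContinuousOn_of_continuous hf.continuousOn hV
  rw [mem_map, mem_inf_principal] at huc
  refine ⟨_, huc, fun l hlen hl hsm => h _ (by simpa using hlen) ?_ ?_⟩
  · simpa using fun x hx => hKK' (hl x hx)
  · simpa using fun x hx y hy => hsm x hx y hy ⟨hl x hx, hl y hy⟩

lemma VanishesOn.mono {K K' : Set X} (hKK' : K ⊆ K') {m : ℕ} {κ : List X → ZMod 2}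
    (h : VanishesOn K' m κ) : VanishesOn K m κ := by
  obtain ⟨V, hV, h⟩ := h
  exact ⟨V, hV, fun l hlen hl => h l hlen fun x hx => hKK' (hl x hx)⟩

lemma VanishesOn.add {K : Set X} {m : ℕ} {κ κ' : List X → ZMod 2}
    (h : VanishesOn K m κ) (h' : VanishesOn K m κ') : VanishesOn K m fun l => κ l + κ' l := by
  obtain ⟨V, hV, h⟩ := h
  obtain ⟨V', hV', h'⟩ := h'
  refine ⟨V ∩ V', inter_mem hV hV', fun l hlen hl hsm => ?_⟩
  simp only [h l hlen hl fun x hx y hy => (hsm x hx y hy).1,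
    h' l hlen hl fun x hx y hy => (hsm x hx y hy).2, add_zero]

lemma VanishesOn.congr {K : Set X} {m : ℕ} {κ κ' : List X → ZMod 2}
    (h : VanishesOn K m κ) (hκ : ∀ l : List X, l.length = m → κ l = κ' l) :
    VanishesOn K m κ' := by
  obtain ⟨V, hV, h⟩ := h
  exact ⟨V, hV, fun l hlen hl hsm => by rw [← hκ l hlen, h l hlen hl hsm]⟩

lemma exists_unitInterval_steps {ε : ℝ} (hε : 0 < ε) :
    ∃ (t : ℕ → I) (M : ℕ), t 0 = 0 ∧ t M = 1 ∧ ∀ i, dist (t i) (t (i + 1)) < ε := by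
  obtain ⟨M, hM⟩ := exists_nat_one_div_lt hε
  have hM' : (0 : ℝ) < M + 1 := by positivity
  refine ⟨fun i => projIcc 0 1 zero_le_one (i / (M + 1)), M + 1, ?_, ?_, fun i => ?_⟩
  · exact projIcc_of_le_left _ (by simp)
  · exact projIcc_of_right_le _ (by push_cast; rw [div_self hM'.ne'])
  · rw [Subtype.dist_eq, Real.dist_eq]
    refine (abs_projIcc_sub_projIcc _).trans_lt ?_
    rwa [← sub_div, abs_div, abs_of_pos hM', show ((i : ℝ) - ((i + 1 : ℕ) : ℝ)) = -1 by
      push_cast; ring, abs_neg, abs_one]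

/-- On a contractible space every cocycle is locally a coboundary over compact sets. -/
lemma exists_primitive [ContractibleSpace X] {K : Set X} (hK : IsCompact K) :
    ∃ K' : Set X, IsCompact K' ∧ K ⊆ K' ∧ ∀ (m : ℕ) (κ : List X → ZMod 2),
      VanishesOn K' (m + 1) (coboundary κ) →
      ∃ μ : List X → ZMod 2, VanishesOn K m fun l => coboundary μ l + κ l := by
  obtain ⟨p, ⟨F⟩⟩ := id_nullhomotopic X
  have hcpt : IsCompact ((univ : Set I) ×ˢ K) := isCompact_univ.prod hK
  refine ⟨insert p (F '' (univ ×ˢ K)), (hcpt.image F.continuous).insert p, fun x hx =>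
    .inr ⟨(0, x), ⟨mem_univ _, hx⟩, F.apply_zero x⟩, fun m κ ⟨V, hV, hκ⟩ => ?_⟩
  have huc := hcpt.uniformContinuousOn_of_continuous F.continuous.continuousOn hV
  rw [mem_map, mem_inf_principal] at huc
  obtain ⟨A, hA, B, hB, hAB⟩ := entourageProd_subset huc
  obtain ⟨ε, hε, hεA⟩ := Metric.mem_uniformity_dist.1 hA
  obtain ⟨t, M, ht0, htM, ht⟩ := exists_unitInterval_steps hε
  have hsmall : ∀ i x y, x ∈ K → y ∈ K → (x, y) ∈ B → ∀ s s', s = t i ∨ s = t (i + 1) →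
      s' = t i ∨ s' = t (i + 1) → (F (s, x), F (s', y)) ∈ V := by
    intro i x y hx hy hxy s s' hs hs'
    have hss' : dist s s' < ε := by
      have := ht i
      rcases hs with rfl | rfl <;> rcases hs' with rfl | rfl <;> simp_all [dist_comm]
    have : ((s, x), (s', y)) ∈ entourageProd A B := ⟨hεA hss', hxy⟩
    exact hAB this ⟨⟨mem_univ _, hx⟩, mem_univ _, hy⟩
  obtain ⟨μ, hμ⟩ := exists_coboundary_eq_of_steps (κ := κ)
    (l₀ := fun l => l.length = m ∧ (∀ x ∈ l, x ∈ K) ∧ ∀ x ∈ l, ∀ y ∈ l, (x, y) ∈ B)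
    (fun i x => F (t i, x)) (fun i l ⟨hlen, hl, hsm⟩ => prism_eq_zero fun l' hlen' hl' =>
      hκ l' (by rw [hlen', hlen]) (fun z hz => by
        obtain ⟨x, hx, rfl | rfl⟩ := hl' z hz <;>
          exact .inr ⟨_, ⟨mem_univ _, hl x hx⟩, rfl⟩) fun z hz w hw => by
        obtain ⟨x, hx, hzx⟩ := hl' z hz
        obtain ⟨y, hy, hwy⟩ := hl' w hw
        have := hsmall i x y (hl x hx) (hl y hy) (hsm x hx y hy)
        rcases hzx with rfl | rfl <;> rcases hwy with rfl | rfl <;>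
          exact this _ _ (by simp) (by simp)) M
  refine ⟨fun l => μ l + κ (p :: l.map fun _ => p), B, hB, fun l hlen hl hsm => ?_⟩
  have hcone := coboundary_comp_map (fun _ => p) (fun l => κ (p :: l)) l
  have hp : coboundary κ (p :: l.map fun _ => p) = 0 := by
    refine hκ _ (by simpa using hlen) ?_ ?_
    · simp
    · simp [refl_mem_uniformity hV]
  rw [coboundary] at hp
  beta_reduce
  rw [coboundary_add, hμ l ⟨hlen, hl, hsm⟩, hcone]
  have h0 : (l.map fun x => F (t 0, x)) = l := by simp [ht0]
  have h1 : (l.map fun x => F (t M, x)) = l.map fun _ => p := by simp [htM]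
  rw [h0, h1]
  linear_combination hp + κ l * (CharTwo.two_eq_zero (R := ZMod 2))

end Cochain

section Smith

open Set Filter Topology Uniformity

variable {X : Type*} (s : ℕ → X → ZMod 2)

/-- The cup product `δ s k ∪ ⋯ ∪ δ s 1 ∪ δ s 0`, on lists of `k + 2` points. -/
def cupCoboundary : List X → ZMod 2
  | [] => 1
  | [_] => 1
  | x :: y :: l => (s l.length x + s l.length y) * cupCoboundary (y :: l)

/-- The cup product `s k ∪ δ s (k - 1) ∪ ⋯ ∪ δ s 0`, on lists of `k + 1` points. -/
def smithCochain : List X → ZMod 2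
  | [] => 0
  | x :: l => s l.length x * cupCoboundary s (x :: l)

lemma coboundary_cupCoboundary (x y : X) (l : List X) :
    coboundary (cupCoboundary s) (x :: y :: l) = 0 := by
  induction l generalizing x y with
  | nil => simp [coboundary, cupCoboundary, CharTwo.add_self_eq_zero]
  | cons z l ih =>
    have hy : cupCoboundary s (z :: l) +
      coboundary (fun l' => cupCoboundary s (y :: l')) (z :: l) = 0 := ih y z
    have hxy : coboundary (fun l' => cupCoboundary s (x :: y :: l')) (z :: l) =
        (s l.length x + s l.length y) *
          coboundary (fun l' => cupCoboundary s (y :: l')) (z :: l) := by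
      rw [← coboundary_const_mul]
      refine coboundary_congr fun l' _ hlen => ?_
      have hlen : l'.length = l.length := by simpa using hlen
      simp [cupCoboundary, hlen]
    rw [coboundary, coboundary, hxy]
    simp only [cupCoboundary] at hy ⊢
    linear_combination (s l.length x + s l.length y) * hy
      + (s l.length z * cupCoboundary s (z :: l)) * (CharTwo.two_eq_zero (R := ZMod 2))

lemma coboundary_smithCochain (x y : X) (l : List X) :
    coboundary (smithCochain s) (x :: y :: l) = cupCoboundary s (x :: y :: l) := by
  have hx : cupCoboundary s (y :: l) +
    coboundary (fun l' => cupCoboundary s (x :: l')) (y :: l) = 0 :=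
    coboundary_cupCoboundary s x y l
  have hs : coboundary (fun l' => smithCochain s (x :: l')) (y :: l) =
      s l.length x * coboundary (fun l' => cupCoboundary s (x :: l')) (y :: l) := by
    rw [← coboundary_const_mul]
    refine coboundary_congr fun l' _ hlen => ?_
    have hlen : l'.length = l.length := by simpa using hlen
    simp [smithCochain, hlen]
  rw [coboundary, hs]
  simp only [smithCochain, cupCoboundary]
  linear_combination s l.length x * hx -
    s l.length x * cupCoboundary s (y :: l) * (CharTwo.two_eq_zero (R := ZMod 2))

variable {s}

lemma cupCoboundary_eq_zero {l : List X} {j : ℕ} (hj : j + 2 ≤ l.length)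
    (h : ∀ x ∈ l, ∀ y ∈ l, s j x = s j y) : cupCoboundary s l = 0 := by
  induction l with
  | nil => simp at hj
  | cons x l ih =>
    cases l with
    | nil => simp at hj
    | cons y l =>
      rw [cupCoboundary]
      by_cases hjl : j = l.length
      · rw [← hjl, h x (by simp) y (by simp), CharTwo.add_self_eq_zero, zero_mul]
      · rw [ih (by simp at hj ⊢; omega) fun x hx y hy =>
          h x (List.mem_cons_of_mem _ hx) y (List.mem_cons_of_mem _ hy), mul_zero]

lemma cupCoboundary_map {l : List X} {τ : X → X} {c : ℕ → ZMod 2}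
    (h : ∀ x ∈ l, ∀ j, s j (τ x) = s j x + c j) :
    cupCoboundary s (l.map τ) = cupCoboundary s l := by
  induction l with
  | nil => rfl
  | cons x l ih =>
    cases l with
    | nil => rfl
    | cons y l =>
      have ih := ih fun x hx => h x (List.mem_cons_of_mem _ hx)
      simp only [List.map_cons, cupCoboundary, List.length_map] at ih ⊢
      rw [ih, h x (by simp), h y (by simp)]
      linear_combination c l.length * cupCoboundary s (y :: l) *
        (CharTwo.two_eq_zero (R := ZMod 2))

lemma smithCochain_eq_zero {l : List X} {j : ℕ} (hj : j + 2 ≤ l.length)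
    (h : ∀ x ∈ l, ∀ y ∈ l, s j x = s j y) : smithCochain s l = 0 := by
  cases l with
  | nil => rfl
  | cons x l => rw [smithCochain, cupCoboundary_eq_zero hj h, mul_zero]

variable [UniformSpace X]

/-- The functions `s j` can serve as sign functions for an involution `τ`: locally on compact sets,
either `s 0` is constant, or `τ` switches the values of all the `s j` with `0 < j` while one of
`s 1, …, s n` is constant. -/
def IsSignFamily (τ : X → X) (n : ℕ) (s : ℕ → X → ZMod 2) : Prop :=
  (∀ x, s 0 (τ x) = s 0 x) ∧ ∀ K : Set X, IsCompact K → ∃ V ∈ 𝓤 X, ∀ l : List X,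
    (∀ x ∈ l, x ∈ K) → (∀ x ∈ l, ∀ y ∈ l, (x, y) ∈ V) →
    (∀ x ∈ l, ∀ y ∈ l, s 0 x = s 0 y) ∨
      ((∀ x ∈ l, ∀ j, 0 < j → s j (τ x) = s j x + 1) ∧
        ∃ j ≤ n, ∀ x ∈ l, ∀ y ∈ l, s j x = s j y)

variable {τ : X → X} {n : ℕ}

lemma IsSignFamily.vanishesOn_coboundary (h : IsSignFamily τ n s) {K : Set X} (hK : IsCompact K) :
    VanishesOn K (n + 2) (coboundary (smithCochain s)) := by
  obtain ⟨V, hV, h⟩ := h.2 K hK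
  refine ⟨V, hV, fun l hlen hl hsm => ?_⟩
  match l, hlen with
  | x :: y :: l, hlen =>
    rw [coboundary_smithCochain]
    rcases h _ hl hsm with h0 | ⟨-, j, hj, h⟩
    · exact cupCoboundary_eq_zero (by simp) h0
    · exact cupCoboundary_eq_zero (by omega) h

lemma IsSignFamily.vanishesOn_transfer (h : IsSignFamily τ n s) {K : Set X} (hK : IsCompact K)
    {m : ℕ} (hm : 2 ≤ m) :
    VanishesOn K m fun l => coboundary (smithCochain s) l +
      (smithCochain s l + smithCochain s (l.map τ)) := by
  obtain ⟨V, hV, hl'⟩ := h.2 K hK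
  refine ⟨V, hV, fun l hlen hl hsm => ?_⟩
  match l, hlen with
  | [], hlen => simp at hlen; omega
  | [_], hlen => simp at hlen; omega
  | x :: y :: l, hlen =>
    beta_reduce
    rw [coboundary_smithCochain]
    rcases hl' _ hl hsm with h0 | ⟨hτ, -⟩
    · rw [smithCochain_eq_zero (by simp) h0, cupCoboundary_eq_zero (by simp) h0,
        smithCochain_eq_zero (j := 0) (by simp)]
      · simp
      · intro z hz w hw
        obtain ⟨z, hz', rfl⟩ := List.mem_map.1 hz
        obtain ⟨w, hw', rfl⟩ := List.mem_map.1 hw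
        rw [h.1, h.1, h0 z hz' w hw']
    · have := cupCoboundary_map (s := s) (τ := τ) (c := fun j => if j = 0 then 0 else 1)
        (l := x :: y :: l) fun x hx j => by
          rcases Nat.eq_zero_or_pos j with rfl | hj
          · simp [h.1]
          · simp [hτ x hx j hj, hj.ne']
      rw [List.map_cons] at this ⊢
      rw [smithCochain, smithCochain, this, List.length_map, hτ x (by simp) _ (by simp)]
      linear_combination (1 + s (y :: l).length x) * cupCoboundary s (x :: y :: l) *
        (CharTwo.two_eq_zero (R := ZMod 2))

lemma IsSignFamily.exists_correction [ContractibleSpace X] (h : IsSignFamily τ n s)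
    (hτ : Continuous τ) (hττ : ∀ x, τ (τ x) = x) {m : ℕ} (hm : 1 ≤ m) (hmn : m ≤ n + 1)
    {K : Set X} (hK : IsCompact K) :
    ∃ κ : List X → ZMod 2, VanishesOn K (m + 1)
      (coboundary fun l => smithCochain s l + (κ l + κ (l.map τ))) := by
  induction hmn using Nat.decreasingInduction generalizing K with
  | self =>
    refine ⟨fun _ => 0, ?_⟩
    simpa using h.vanishesOn_coboundary hK
  | of_succ m _ ih =>
    obtain ⟨K', hK', hKK', hprim⟩ := exists_primitive (hK.union (hK.image hτ))
    obtain ⟨κ, hκ⟩ := ih (by omega) hK'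
    obtain ⟨μ, hμ⟩ := hprim _ _ hκ
    refine ⟨μ, (((hμ.mono subset_union_left).add (hμ.comp_map hK hτ fun x hx =>
      .inr (mem_image_of_mem τ hx))).add (h.vanishesOn_transfer hK (by omega))).congr
        fun l _ => ?_⟩
    have hl : (l.map τ).map τ = l := by simp [Function.comp_def, hττ]
    simp only [coboundary_add, coboundary_comp_map, hl]
    linear_combination (smithCochain s l + smithCochain s (l.map τ) + κ l + κ (l.map τ)) *
      (CharTwo.two_eq_zero (R := ZMod 2))

/-- An invariant sign function takes the same value at any two fixed points. -/
theorem IsSignFamily.apply_eq_of_isFixedPt [ContractibleSpace X] (h : IsSignFamily τ n s)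
    (hτ : Continuous τ) (hττ : ∀ x, τ (τ x) = x) {a b : X} (ha : τ a = a) (hb : τ b = b) :
    s 0 a = s 0 b := by
  obtain ⟨K', hK', hKK', hprim⟩ := exists_primitive (X := X) (K := {a, b}) (by simp)
  obtain ⟨κ, hκ⟩ := h.exists_correction hτ hττ le_rfl (by omega) hK'
  obtain ⟨μ, V, hV, hμ⟩ := hprim _ _ hκ
  have key : ∀ x ∈ ({a, b} : Set X), τ x = x → s 0 x = μ [] := by
    intro x hx hxτ
    have := hμ [x] rfl (by simpa using hx) (by simpa using refl_mem_uniformity hV)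
    simp only [coboundary, smithCochain, cupCoboundary, List.map_cons, List.map_nil, hxτ,
      List.length_nil] at this
    linear_combination this - (μ [] + κ [x]) * (CharTwo.two_eq_zero (R := ZMod 2))
  rw [key a (by simp) ha, key b (by simp) hb]

end Smith

section Separation

open Set Filter Topology Uniformity

variable {X : Type*} {n : ℕ}

/-- The `j`-th coordinate of `G`, extended by zero to all `j : ℕ`. -/
def natCoord (G : X → Fin n → ℝ) (j : ℕ) (x : X) : ℝ :=
  if hj : j < n then G x ⟨j, hj⟩ else 0

open Classical in
/-- The indicator of `h > 1/2`, followed by the signs of the coordinates of `G`, where vanishing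
coordinates get the lexicographic sign of `G`. -/
noncomputable def signFamily (h : X → ℝ) (G : X → Fin n → ℝ) : ℕ → X → ZMod 2
  | 0, x => if 1 / 2 < h x then 1 else 0
  | j + 1, x =>
    if 0 < natCoord G j x ∨ (natCoord G j x = 0 ∧ 0 < toLex (G x)) then 1 else 0

lemma signFamily_of_neg {h : X → ℝ} {G : X → Fin n → ℝ} {x y : X} (hxy : G y = -G x)
    (hx : G x ≠ 0) (j : ℕ) : signFamily h G (j + 1) y = signFamily h G (j + 1) x + 1 := by
  have hlex : 0 < toLex (G y) ↔ ¬ 0 < toLex (G x) := by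
    rw [hxy, toLex_neg, neg_pos]
    have hx' : toLex (G x) ≠ 0 := hx
    rcases lt_trichotomy (toLex (G x)) 0 with h0 | h0 | h0
    · exact iff_of_true h0 h0.not_gt
    · exact absurd h0 hx'
    · exact iff_of_false h0.not_gt (not_not.2 h0)
  have hcoord : natCoord G j y = -natCoord G j x := by
    by_cases hj : j < n <;> simp [natCoord, hj, hxy]
  have h2 : (1 : ZMod 2) + 1 = 0 := rfl
  simp only [signFamily]
  rcases lt_trichotomy (natCoord G j x) 0 with h0 | h0 | h0
  · rw [if_pos (by rw [hcoord]; exact .inl (by linarith)),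
      if_neg (by rintro (h1 | h1) <;> linarith), zero_add]
  · by_cases hl : 0 < toLex (G x)
    · rw [if_neg (by rw [hcoord, hlex, h0]; simp [hl]), if_pos (.inr ⟨h0, hl⟩), h2]
    · rw [if_pos (by rw [hcoord, hlex, h0]; simp [hl]), if_neg (by simp [h0, hl]), zero_add]
  · rw [if_neg (by rw [hcoord]; rintro (h1 | h1) <;> linarith), if_pos (.inl h0), h2]

variable [UniformSpace X] {τ : X → X} {h : X → ℝ} {G : X → Fin n → ℝ}

lemma isSignFamily_signFamily (hc : Continuous h) (hτ : ∀ x, h (τ x) = h x) (hGc : Continuous G)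
    (hGτ : ∀ x, G (τ x) = -G x) (hG : ∀ x, 0 < h x → h x < 1 → G x ≠ 0) :
    IsSignFamily τ n (signFamily h G) := by
  refine ⟨fun x => by simp only [signFamily, hτ], fun K hK => ?_⟩
  obtain ⟨r, hr, hrG⟩ := (hK.inter_right (isClosed_Icc.preimage hc :
    IsClosed (h ⁻¹' Icc (1 / 4) (3 / 4)))).exists_forall_le' (f := fun x => ‖G x‖) (a := 0)
    hGc.norm.continuousOn fun x ⟨_, hx⟩ =>
      norm_pos_iff.2 (hG x (by linarith [hx.1]) (by linarith [hx.2]))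
  have uh := hK.uniformContinuousOn_of_continuous hc.continuousOn
    (Metric.dist_mem_uniformity (show (0 : ℝ) < 1 / 4 by norm_num))
  have uG := hK.uniformContinuousOn_of_continuous hGc.continuousOn (Metric.dist_mem_uniformity hr)
  rw [mem_map, mem_inf_principal] at uh uG
  refine ⟨_, inter_mem uh uG, fun l hl hsm => or_iff_not_imp_left.2 fun hne => ?_⟩
  have dh : ∀ x ∈ l, ∀ y ∈ l, dist (h x) (h y) < 1 / 4 := fun x hx y hy =>
    (hsm x hx y hy).1 ⟨hl x hx, hl y hy⟩
  have dG : ∀ x ∈ l, ∀ y ∈ l, dist (G x) (G y) < r := fun x hx y hy =>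
    (hsm x hx y hy).2 ⟨hl x hx, hl y hy⟩
  obtain ⟨x, hx, y, hy, hx2, hy2⟩ : ∃ x ∈ l, ∃ y ∈ l, 1 / 2 < h x ∧ h y ≤ 1 / 2 := by
    by_contra! hcon
    refine hne fun x hx y hy => ?_
    have := hcon x hx y hy
    have := hcon y hy x hx
    simp only [signFamily]
    split_ifs <;> first | rfl | (exfalso; tauto)
  have hmid : ∀ z ∈ l, h z ∈ Icc (1 / 4 : ℝ) (3 / 4) := fun z hz => by
    have h1 := abs_lt.1 (dh x hx z hz)
    have h2 := abs_lt.1 (dh y hy z hz)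
    constructor <;> linarith
  refine ⟨fun z hz j hj => ?_, ?_⟩
  · obtain ⟨j, rfl⟩ := Nat.exists_eq_add_of_lt hj
    rw [zero_add]
    have := hmid z hz
    exact signFamily_of_neg (hGτ z) (hG z (by linarith [this.1]) (by linarith [this.2])) j
  · obtain ⟨j, hj⟩ : ∃ j, r ≤ |G x j| := by
      by_contra! hcon
      exact (hrG x ⟨hl x hx, hmid x hx⟩).not_gt ((pi_norm_lt_iff hr).2 hcon)
    refine ⟨j + 1, j.2, ?_⟩
    have key : ∀ z ∈ l, signFamily h G (j + 1) z = if 0 < G x j then 1 else 0 := by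
      intro z hz
      have hd := abs_lt.1 ((dist_le_pi_dist (G x) (G z) j).trans_lt (dG x hx z hz))
      have hcoord : natCoord G j z = G z j := by simp [natCoord]
      simp only [signFamily, hcoord]
      rcases le_abs.1 hj with h0 | h0
      · rw [if_pos (.inl (by linarith)), if_pos (by linarith)]
      · rw [if_neg, if_neg (by linarith)]
        rintro (h1 | ⟨h1, -⟩) <;> linarith
    intro z hz w hw
    rw [key z hz, key w hw]

/-- An involution of a contractible space cannot have two fixed points which are separated by an
invariant function `h` whose intermediate values occur only where an odd map `G` to `ℝⁿ`
is nonzero. -/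
theorem not_separated_of_isFixedPt [ContractibleSpace X] (hτ : Continuous τ)
    (hττ : ∀ x, τ (τ x) = x) (hc : Continuous h) (hhτ : ∀ x, h (τ x) = h x) (hGc : Continuous G)
    (hGτ : ∀ x, G (τ x) = -G x) (hG : ∀ x, 0 < h x → h x < 1 → G x ≠ 0) {a b : X}
    (ha : τ a = a) (hb : τ b = b) (h1 : h a = 1) : h b ≠ 0 := by
  intro h0
  have := (isSignFamily_signFamily hc hhτ hGc hGτ hG).apply_eq_of_isFixedPt hτ hττ ha hb
  norm_num [signFamily, h0, h1] at this

end Separation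

section Cover

open unitInterval

/-- The universal covering map of the torus. -/
def torusProj (n : ℕ) : C(Fin n → ℝ, Torus n) :=
  ⟨fun y i => (y i : AddCircle (1 : ℝ)),
    continuous_pi fun i => continuous_quotient_mk'.comp (continuous_apply i)⟩

variable {n : ℕ} {Y : Type*} [TopologicalSpace Y]

lemma torusProj_add (x y : Fin n → ℝ) : torusProj n (x + y) = torusProj n x + torusProj n y := rfl

lemma torusProj_sub (x y : Fin n → ℝ) : torusProj n (x - y) = torusProj n x - torusProj n y := rfl

lemma torusProj_surjective : Function.Surjective (torusProj n) := fun x =>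
  ⟨fun i => (QuotientAddGroup.mk_surjective (x i)).choose,
    funext fun i => (QuotientAddGroup.mk_surjective (x i)).choose_spec⟩

lemma one_le_norm_of_torusProj_eq_zero {v : Fin n → ℝ} (hv : torusProj n v = 0) (h0 : v ≠ 0) :
    1 ≤ ‖v‖ := by
  obtain ⟨i, hi⟩ := Function.ne_iff.1 h0
  obtain ⟨k, hk⟩ := (AddCircle.coe_eq_zero_iff (1 : ℝ)).1 (congrFun hv i)
  refine le_trans ?_ (norm_le_pi_norm v i)
  rw [← hk] at hi ⊢
  have hk0 : k ≠ 0 := by rintro rfl; simp at hi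
  rw [zsmul_one, Real.norm_eq_abs, ← Int.cast_abs]
  exact_mod_cast Int.one_le_abs hk0

lemma exists_homotopy_lift (F : C(I × Y, Torus n)) (f : C(Y, Fin n → ℝ))
    (h : ∀ y, F (0, y) = torusProj n (f y)) :
    ∃ L : C(I × Y, Fin n → ℝ), (∀ p, torusProj n (L p) = F p) ∧ ∀ y, L (0, y) = f y := by
  have cov := AddCircle.isCoveringMap_coe (1 : ℝ)
  have key (i : Fin n) : ∃ L : C(I × Y, ℝ), (∀ p, (L p : AddCircle (1 : ℝ)) = F p i) ∧
      ∀ y, L (0, y) = f y i := by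
    let Fi : C(I × Y, AddCircle (1 : ℝ)) := ⟨fun p => F p i, by fun_prop⟩
    let fi : C(Y, ℝ) := ⟨fun y => f y i, by fun_prop⟩
    have h0 (y) : Fi (0, y) = (fi y : AddCircle (1 : ℝ)) := congrFun (h y) i
    exact ⟨cov.liftHomotopy Fi fi h0, congrFun (cov.liftHomotopy_lifts Fi fi h0),
      cov.liftHomotopy_zero Fi fi h0⟩
  choose L hL hL0 using key
  exact ⟨⟨fun p i => L i p, by fun_prop⟩, fun p => funext fun i => hL i p,
    fun y => funext fun i => hL0 i y⟩

lemma lift_sub_lift_eq [PreconnectedSpace Y] {f g : Y → Fin n → ℝ} (hf : Continuous f)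
    (hg : Continuous g) (h : ∀ y, torusProj n (f y) = torusProj n (g y)) (y y' : Y) :
    f y - g y = f y' - g y' := by
  have h0 (y) : torusProj n (f y - g y) = 0 := by rw [torusProj_sub, h, sub_self]
  refine funext fun i => (AddCircle.isCoveringMap_coe (1 : ℝ)).const_of_comp
    (g := fun y => (f y - g y) i) (by fun_prop) (fun a a' => ?_) y y'
  exact (congrFun (h0 a) i).trans (congrFun (h0 a') i).symm

lemma exists_lift [ContractibleSpace Y] (f : C(Y, Torus n)) (a : Y) {y₀ : Fin n → ℝ}
    (h : torusProj n y₀ = f a) :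
    ∃ g : C(Y, Fin n → ℝ), (∀ y, torusProj n (g y) = f y) ∧ g a = y₀ := by
  obtain ⟨b, ⟨H⟩⟩ := id_nullhomotopic Y
  obtain ⟨z, hz⟩ := torusProj_surjective (f b)
  obtain ⟨L, hL, -⟩ := exists_homotopy_lift (f.comp H.symm.toContinuousMap) (.const Y z)
    fun y => by simp [hz]
  refine ⟨⟨fun y => L (1, y) + (y₀ - L (1, a)), by fun_prop⟩, fun y => ?_, by simp⟩
  have h1 (y) : torusProj n (L (1, y)) = f y := by simp [hL]
  simp [torusProj_add, torusProj_sub, h1, h]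

instance : ContractibleSpace I := (convex_Icc (0 : ℝ) 1).contractibleSpace ⟨0, by simp⟩

variable {N : Type*} [TopologicalSpace N]

/-- The covering of `N` obtained by pulling back the universal covering of the torus along `φ`. -/
abbrev TorusCover (φ : C(N, Torus n)) := {p : N × (Fin n → ℝ) // φ p.1 = torusProj n p.2}

theorem contractibleSpace_torusCover (e : ContinuousMap.HomotopyEquiv N (Torus n)) :
    ContractibleSpace (TorusCover e.toFun) := by
  set φ := e.toFun
  set ψ := e.invFun
  obtain ⟨H⟩ := e.left_inv.symm
  obtain ⟨H'⟩ := e.right_inv.symm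
  have : PathConnectedSpace N := by
    have : Nonempty N := ⟨ψ 0⟩
    refine ⟨‹_›, fun x y => ?_⟩
    have hx (x : N) : Joined x (ψ (φ x)) :=
      ⟨⟨⟨fun t => H (t, x), by fun_prop⟩, by simp, by simp [φ, ψ]⟩⟩
    exact ((hx x).trans
      ((PathConnectedSpace.joined (φ x) (φ y)).map ψ.continuous)).trans (hx y).symm
  obtain ⟨L, hL, hL0⟩ := exists_homotopy_lift (n := n) (Y := TorusCover φ)
    ⟨fun p => φ (H (p.1, p.2.1.1)), by fun_prop⟩ ⟨fun p => p.1.2, by fun_prop⟩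
    fun p => by simpa using p.2
  obtain ⟨M, hM, hM0⟩ := exists_homotopy_lift (n := n) (Y := Fin n → ℝ)
    ⟨fun p => H' (p.1, torusProj n p.2), by fun_prop⟩ (.id _) fun y => by simp
  have hLk (p : TorusCover φ) (k : Fin n → ℝ) (hp : φ p.1.1 = torusProj n (p.1.2 + k)) :
      L (1, ⟨(p.1.1, p.1.2 + k), hp⟩) = L (1, p) + k := by
    have := lift_sub_lift_eq (f := fun t : I => L (t, ⟨(p.1.1, p.1.2 + k), hp⟩))
      (g := fun t => L (t, p)) (by fun_prop) (by fun_prop) (fun t => by simp [hL]) 1 0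
    simp only [hL0, ContinuousMap.coe_mk, add_sub_cancel_left] at this
    exact sub_eq_iff_eq_add'.1 this
  have hMk (y k : Fin n → ℝ) (hk : torusProj n k = 0) : M (1, y + k) = M (1, y) + k := by
    have := lift_sub_lift_eq (f := fun t : I => M (t, y + k)) (g := fun t => M (t, y))
      (by fun_prop) (by fun_prop) (fun t => by simp [hM, torusProj_add, hk]) 1 0
    simp only [hM0, ContinuousMap.id_apply, add_sub_cancel_left] at this
    exact sub_eq_iff_eq_add'.1 this
  have hL1 (p : TorusCover φ) : torusProj n (L (1, p)) = φ (ψ (φ p.1.1)) := by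
    simp [hL, φ, ψ]
  have hM1 (y : Fin n → ℝ) : torusProj n (M (1, y)) = φ (ψ (torusProj n y)) := by
    simp [hM, φ, ψ]
  have hD (p p' : TorusCover φ) : L (1, p) - M (1, p.1.2) = L (1, p') - M (1, p'.1.2) := by
    obtain ⟨γ⟩ := PathConnectedSpace.joined p.1.1 p'.1.1
    obtain ⟨c, hc, hc0⟩ := exists_lift (φ.comp γ.toContinuousMap) 0 (y₀ := p.1.2)
      (by simpa using p.2.symm)
    let P : C(I, TorusCover φ) := ⟨fun t => ⟨(γ t, c t), (hc t).symm⟩, by fun_prop⟩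
    have h0 : P 0 = p := Subtype.ext (Prod.ext (by simp [P]) (by simp [P, hc0]))
    have hk : torusProj n (p'.1.2 - c 1) = 0 := by
      rw [torusProj_sub, hc, ← p'.2]; simp
    have h1 : p' = ⟨((P 1).1.1, (P 1).1.2 + (p'.1.2 - c 1)), by
        rw [torusProj_add, hk, add_zero]; exact (P 1).2⟩ :=
      Subtype.ext (Prod.ext (by simp [P]) (by simp [P]))
    have key := lift_sub_lift_eq (f := fun t => L (1, P t)) (g := fun t => M (1, (P t).1.2))
      (by fun_prop) (by fun_prop) (fun t => by rw [hL1, hM1, (P t).2]) 0 1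
    simp only [h0] at key
    rw [key, h1, hLk, hMk _ _ hk]
    abel
  obtain ⟨y₀, hy₀⟩ := torusProj_surjective (φ (ψ 0))
  let p₀ : TorusCover φ := ⟨(ψ 0, y₀), hy₀.symm⟩
  set D := L (1, p₀) - M (1, p₀.1.2) with hD₀
  have hDproj : torusProj n D = 0 := by rw [hD₀, torusProj_sub, hL1, hM1, ← p₀.2, sub_self]
  let q : C(Fin n → ℝ, TorusCover φ) := ⟨fun y => ⟨(ψ (torusProj n y), M (1, y) + D), by
    rw [torusProj_add, hDproj, hM1, add_zero]⟩, by fun_prop⟩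
  rw [contractible_iff_id_nullhomotopic]
  let pr : C(TorusCover φ, Fin n → ℝ) := ⟨fun p => p.1.2, by fun_prop⟩
  obtain ⟨b, hb⟩ : ((q.comp (.id _)).comp pr).Nullhomotopic :=
    ((id_nullhomotopic (Fin n → ℝ)).comp_right q).comp_left pr
  refine ⟨b, .trans ⟨⟨⟨fun p => ⟨(H (p.1, p.2.1.1), L p), (hL p).symm⟩, by fun_prop⟩,
    fun p => ?_, fun p => ?_⟩⟩ hb⟩
  · exact Subtype.ext (Prod.ext (by simp) (by simp [hL0]))
  · refine Subtype.ext (Prod.ext ?_ ?_)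
    · have := p.2
      simp [q, pr, ← this, φ, ψ]
    · have := hD p p₀
      simp only [q, pr, ContinuousMap.coe_mk, ContinuousMap.comp_apply, ContinuousMap.id_apply, hD₀,
        ← this]
      abel

end Cover

section Chart

open Set Topology

lemma LocallyEuclidean.exists_injOn_nhds {n : ℕ} {N : Type} [TopologicalSpace N] [CompactSpace N]
    [T2Space N] (h : LocallyEuclidean n N) (a : N) :
    ∃ C ∈ 𝓝 a, ∃ g : C(N, Fin n → ℝ), InjOn g C := by
  obtain ⟨U, V, hU, ha, -, ⟨e⟩⟩ := h a
  obtain ⟨C, hC, hCc, hCU⟩ := exists_mem_nhds_isClosed_subset (hU.mem_nhds ha)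
  obtain ⟨g, hg⟩ := ContinuousMap.exists_restrict_eq hCc
    (⟨fun x => (e ⟨x, hCU x.2⟩ : Fin n → ℝ), by fun_prop⟩ : C(C, Fin n → ℝ))
  refine ⟨C, hC, g, fun x hx y hy hxy => ?_⟩
  have hgx := DFunLike.congr_fun hg ⟨x, hx⟩
  have hgy := DFunLike.congr_fun hg ⟨y, hy⟩
  simp only [ContinuousMap.restrict_apply, ContinuousMap.coe_mk] at hgx hgy
  rw [hgx, hgy, Subtype.coe_inj, e.injective.eq_iff, Subtype.mk.injEq] at hxy
  exact hxy

/-- A lift of an involution to the cover which fixes a point over an isolated fixed point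
fixes no other point over it. -/
theorem eq_of_lift_eq_self {n : ℕ} {N : Type} [UniformSpace N] [CompactSpace N] [T2Space N]
    (hman : LocallyEuclidean n N) {φ : C(N, Torus n)} [ContractibleSpace (TorusCover φ)]
    {σ : N → N} (hσ : Continuous σ) (hσσ : ∀ x, σ (σ x) = x) {a : N} (ha : σ a = a)
    (hiso : ∀ᶠ x in 𝓝 a, σ x = x → x = a) {f : TorusCover φ → Fin n → ℝ} (hf : Continuous f)
    (hfσ : ∀ p, torusProj n (f p) = φ (σ p.1.1)) {y₀ y : Fin n → ℝ} (hy₀ : φ a = torusProj n y₀)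
    (hf₀ : f ⟨(a, y₀), hy₀⟩ = y₀) (hy : φ a = torusProj n y) (hfy : f ⟨(a, y), hy⟩ = y) :
    y = y₀ := by
  let τ : TorusCover φ → TorusCover φ := fun p => ⟨(σ p.1.1, f p), (hfσ p).symm⟩
  have hτ : Continuous τ := by fun_prop
  let a₀ : TorusCover φ := ⟨(a, y₀), hy₀⟩
  have hτa : τ a₀ = a₀ := Subtype.ext (Prod.ext ha hf₀)
  have hττ (p) : τ (τ p) = p := by
    have := lift_sub_lift_eq (f := fun p => f (τ p)) (g := fun p => p.1.2) (by fun_prop)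
      (by fun_prop) (fun p => by rw [hfσ, hσσ, p.2]) p a₀
    simp only [hτa] at this
    exact Subtype.ext (Prod.ext (hσσ _) (sub_eq_zero.1 (this.trans (sub_eq_zero.2 hf₀))))
  obtain ⟨C, hC, g, hg⟩ := hman.exists_injOn_nhds a
  obtain ⟨U, hU, hUo, haU⟩ := eventually_nhds_iff.1 (hiso.and (Filter.Eventually.and hC
    (hσ.continuousAt.preimage_mem_nhds (by rwa [ha]) : σ ⁻¹' C ∈ 𝓝 a)))
  obtain ⟨u, hu0, hu1, -⟩ := exists_continuous_zero_one_of_isClosed hUo.isClosed_compl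
    (isClosed_singleton (x := a)) (by simpa using haU)
  have hua : u a = 1 := hu1 rfl
  let h₀ : TorusCover φ → ℝ := fun p => u p.1.1 * max 0 (1 - ‖p.1.2 - y₀‖)
  have hh₀ : Continuous h₀ := by fun_prop
  have hh₀a : h₀ a₀ = 1 := by simp [h₀, a₀, hua]
  have eq_of_ne {z} (hz : φ a = torusProj n z) (hne : h₀ ⟨(a, z), hz⟩ ≠ 0) : z = y₀ := by
    by_contra hzy
    refine hne ?_
    have := one_le_norm_of_torusProj_eq_zero (v := z - y₀) (by rw [torusProj_sub, ← hz, ← hy₀,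
      sub_self]) (sub_ne_zero.2 hzy)
    simp [h₀, this]
  have hb : τ ⟨(a, y), hy⟩ = ⟨(a, y), hy⟩ := Subtype.ext (Prod.ext ha hfy)
  refine eq_of_ne hy (left_ne_zero_of_mul (not_separated_of_isFixedPt (h := fun p => h₀ p * h₀ (τ p))
    (G := fun p => g p.1.1 - g (σ p.1.1)) hτ hττ (by fun_prop)
    (fun p => by rw [hττ, mul_comm]) (by fun_prop) (fun p => by simp [τ, hσσ]) ?_ hτa hb
    (by simp only [hτa, hh₀a, mul_one])))
  rintro ⟨⟨x, z⟩, hz⟩ hpos hlt hG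
  have hp := left_ne_zero_of_mul hpos.ne'
  have hxU : x ∈ U := by
    by_contra hx
    exact left_ne_zero_of_mul hp (hu0 hx)
  obtain ⟨hx1, hx2, hx3⟩ := hU x hxU
  obtain rfl := hx1 (hg hx3 hx2 (sub_eq_zero.1 hG).symm)
  obtain rfl := eq_of_ne hz hp
  have : τ ⟨(x, z), hz⟩ = ⟨(x, z), hz⟩ := hτa
  simp only [this] at hlt
  rw [show h₀ ⟨(x, z), hz⟩ = 1 from hh₀a] at hlt
  norm_num at hlt

end Chart

section Winding

open unitInterval

variable {n : ℕ} {N : Type*} [TopologicalSpace N] {φ : C(N, Torus n)}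

/-- The path `γ` lifts along the universal covering of the torus to a path with displacement `v`. -/
def HasDisplacement (φ : C(N, Torus n)) (γ : I → N) (v : Fin n → ℝ) : Prop :=
  ∃ c : C(I, Fin n → ℝ), (∀ t, torusProj n (c t) = φ (γ t)) ∧ c 1 = c 0 + v

lemma exists_hasDisplacement {γ : I → N} (hγ : Continuous γ) : ∃ v, HasDisplacement φ γ v := by
  obtain ⟨y, hy⟩ := torusProj_surjective (φ (γ 0))
  obtain ⟨c, hc, -⟩ := exists_lift ⟨fun t => φ (γ t), by fun_prop⟩ 0 hy
  exact ⟨c 1 - c 0, c, hc, by abel⟩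

lemma HasDisplacement.exists_lift {γ : I → N} {v : Fin n → ℝ} (h : HasDisplacement φ γ v)
    {y : Fin n → ℝ} (hy : torusProj n y = φ (γ 0)) :
    ∃ c : C(I, Fin n → ℝ), (∀ t, torusProj n (c t) = φ (γ t)) ∧ c 0 = y ∧ c 1 = y + v := by
  obtain ⟨c, hc, hc1⟩ := h
  refine ⟨c + .const I (y - c 0), fun t => ?_, by simp, by simp [hc1]; abel⟩
  simp [torusProj_add, torusProj_sub, hc, hy]

lemma HasDisplacement.trans {x y z : N} {γ : Path x y} {γ' : Path y z} {v w : Fin n → ℝ}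
    (h : HasDisplacement φ γ v) (h' : HasDisplacement φ γ' w) :
    HasDisplacement φ (γ.trans γ') (v + w) := by
  obtain ⟨c, hc, hc1⟩ := h
  obtain ⟨c', hc', hc0', hc1'⟩ := h'.exists_lift (y := c 1) (by simp [hc])
  let p : Path (c 0) (c 1) := ⟨c, rfl, rfl⟩
  let p' : Path (c 1) (c' 1) := ⟨c', hc0', rfl⟩
  refine ⟨(p.trans p').toContinuousMap, fun t => ?_, ?_⟩
  · simp only [Path.coe_toContinuousMap, Path.trans_apply]
    split_ifs
    · exact hc _
    · exact hc' _
  · simp [hc1', hc1, add_assoc]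

lemma HasDisplacement.symm {x y : N} {γ : Path x y} {v : Fin n → ℝ}
    (h : HasDisplacement φ γ v) : HasDisplacement φ γ.symm (-v) := by
  obtain ⟨c, hc, hc1⟩ := h
  exact ⟨⟨fun t => c (σ t), by fun_prop⟩, fun t => hc _, by simp [hc1]⟩

lemma HasDisplacement.homotopic [SimplyConnectedSpace (TorusCover φ)] {x y : N} {γ γ' : Path x y}
    {v : Fin n → ℝ} (h : HasDisplacement φ γ v) (h' : HasDisplacement φ γ' v) :
    γ.Homotopic γ' := by
  obtain ⟨c, hc, hc1⟩ := h
  obtain ⟨c', hc', hc0', hc1'⟩ := h'.exists_lift (y := c 0) (by simp [hc])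
  let p : Path (⟨(x, c 0), by simp [hc]⟩ : TorusCover φ) ⟨(y, c 1), by simp [hc]⟩ :=
    ⟨⟨fun t => ⟨(γ t, c t), (hc t).symm⟩, by fun_prop⟩, by simp, by simp⟩
  let p' : Path (⟨(x, c 0), by simp [hc]⟩ : TorusCover φ) ⟨(y, c 1), by simp [hc]⟩ :=
    ⟨⟨fun t => ⟨(γ' t, c' t), (hc' t).symm⟩, by fun_prop⟩, by simp [hc0'], by simp [hc1', hc1]⟩
  exact (SimplyConnectedSpace.paths_homotopic p p').map
    (⟨fun p => p.1.1, by fun_prop⟩ : C(TorusCover φ, N))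

end Winding

/-- If an involution of a compact topological `n`-manifold homotopy equivalent
to the `n`-torus has a fixed point that is isolated in the fixed-point set
(i.e. some open set of `N` meets the fixed set exactly in that point), then the
involution is `H₁`-negative. -/
theorem isolated_fixed_point_H1Negative (n : ℕ)
    (N : Type) [TopologicalSpace N] [T2Space N] [SecondCountableTopology N]
    [CompactSpace N] (hman : LocallyEuclidean n N)
    (hhe : Nonempty (ContinuousMap.HomotopyEquiv N (Torus n)))
    (σ : N → N) (hσ : Continuous σ) (hinvol : σ ∘ σ = id)
    (hiso : ∃ y : N, σ y = y ∧ ∃ U : Set N, IsOpen U ∧ U ∩ {x : N | σ x = x} = {y}) :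
    H1Negative σ hσ := by
  obtain ⟨e⟩ := hhe
  obtain ⟨a, ha, U, hU, hUa⟩ := hiso
  obtain ⟨u, rfl⟩ : ∃ u : UniformSpace N, u.toTopologicalSpace = ‹_› :=
    ⟨uniformSpaceOfCompactR1, rfl⟩
  have hσσ (x) : σ (σ x) = x := congrFun hinvol x
  have hiso : ∀ᶠ x in nhds a, σ x = x → x = a :=
    Filter.eventually_of_mem (hU.mem_nhds (hUa.ge rfl).1) fun x hx hfix => hUa.le ⟨hx, hfix⟩
  have hc := contractibleSpace_torusCover e
  set φ := e.toFun
  obtain ⟨y₀, hy₀⟩ := torusProj_surjective (φ a)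
  obtain ⟨f, hfσ, hf₀⟩ := exists_lift (⟨fun p => φ (σ p.1.1), by fun_prop⟩ :
    C(TorusCover φ, Torus n)) ⟨(a, y₀), hy₀.symm⟩ (y₀ := y₀) (by simp [ha, hy₀])
  have eq_zero {β : Path a a} {v} (h : HasDisplacement φ β v) (h' : HasDisplacement φ (σ ∘ β) v) :
      v = 0 := by
    obtain ⟨c, hc, hc0, hc1⟩ := h.exists_lift (y := y₀) (by simp [hy₀])
    obtain ⟨c', hc', hc0', hc1'⟩ := h'.exists_lift (y := y₀) (by simp [hy₀, ha])
    have hy : φ a = torusProj n (y₀ + v) := by rw [← hc1, hc, β.target]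
    have key := lift_sub_lift_eq (f := fun t => f ⟨(β t, c t), (hc t).symm⟩) (g := c')
      (by fun_prop) (by fun_prop) (fun t => by simp [hfσ, hc']) 1 0
    simp only [hc0, hc1, hc0', hc1', β.source, β.target, hf₀, sub_self] at key
    simpa using eq_of_lift_eq_self hman hσ hσσ ha hiso f.continuous hfσ hy₀.symm hf₀ hy
      (sub_eq_zero.1 key)
  intro x γ q
  have : PathConnectedSpace N := by
    have h : Function.Surjective fun p : TorusCover φ => p.1.1 := fun z =>
      let ⟨y, hy⟩ := torusProj_surjective (φ z); ⟨⟨(z, y), hy.symm⟩, rfl⟩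
    exact h.pathConnectedSpace (by fun_prop)
  obtain ⟨r⟩ := PathConnectedSpace.joined a x
  obtain ⟨v₁, h₁⟩ := exists_hasDisplacement (φ := φ) γ.continuous
  obtain ⟨v₂, h₂⟩ := exists_hasDisplacement (φ := φ) (γ.map hσ).continuous
  obtain ⟨w₁, k₁⟩ := exists_hasDisplacement (φ := φ) r.continuous
  obtain ⟨w₂, k₂⟩ := exists_hasDisplacement (φ := φ) (r.map hσ).continuous
  obtain ⟨w, k⟩ := exists_hasDisplacement (φ := φ) q.continuous
  let α := (r.trans γ).trans r.symm
  have hα : HasDisplacement φ α v₁ := by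
    simpa [add_assoc] using (k₁.trans h₁).trans k₁.symm
  let α' : Path a a := (α.map hσ).cast ha.symm ha.symm
  have hα' : HasDisplacement φ (α.map hσ) v₂ := by
    have := (k₂.trans h₂).trans k₂.symm
    rw [Path.map_symm, ← Path.map_trans, ← Path.map_trans,
      add_right_comm, add_neg_cancel, zero_add] at this
    exact this
  have hσα' : σ ∘ α' = α := funext fun t => hσσ _
  have hβ : HasDisplacement φ (σ ∘ α.trans α') (v₂ + v₁) := by
    have h : HasDisplacement φ (α'.map hσ) v₁ := by rwa [Path.map_coe, hσα']
    have : HasDisplacement φ ((α.map hσ).trans (α'.map hσ)) (v₂ + v₁) :=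
      HasDisplacement.trans hα' h
    rwa [← Path.map_trans] at this
  have hv := eq_zero (hα.trans (γ' := α') hα') (by rwa [add_comm])
  refine HasDisplacement.homotopic (φ := φ) (v := -v₁) ?_ h₁.symm
  have := k.symm.trans (h₂.trans k)
  rwa [add_comm v₂, neg_add_cancel_left, eq_neg_of_add_eq_zero_right hv] at this
end

section
/- Let p be a prime and let G be a finite p-group acting continuously on a topological manifold M (a second-countable Hausdorff space that is locally homeomorphic to ℝ^n for some n). Then the fixed-point set M^G = {x ∈ M | g·x = x for all g ∈ G} is locally path-connected (in the subspace topology). -/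
/-- A topological manifold: a second-countable Hausdorff space in which every
point has an open neighborhood homeomorphic to an open subset of `ℝⁿ` for some `n`. -/
def IsTopologicalManifold (M : Type) [TopologicalSpace M] : Prop :=
  SecondCountableTopology M ∧ T2Space M ∧
    ∀ x : M, ∃ (n : ℕ) (U : Set M) (V : Set (Fin n → ℝ)),
      IsOpen U ∧ x ∈ U ∧ IsOpen V ∧ Nonempty (U ≃ₜ V)

/-- Chains over `R` on `m`-tuples of points of `X`. The empty tuple is included, so the complex
formed by these modules is augmented. -/
abbrev TupleChain (R X : Type*) [CommRing R] (m : ℕ) := (Fin m → X) →₀ R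

namespace TupleChain

open Finsupp

variable {R X Y : Type*} [CommRing R]

/-- Prepend the vertex `a` to every tuple of a chain. -/
noncomputable def cone (a : X) {m : ℕ} : TupleChain R X m →ₗ[R] TupleChain R X (m + 1) :=
  lmapDomain R R fun v => (Fin.cons a v : Fin (m + 1) → X)

/-- The boundary operator. -/
noncomputable def bd : ∀ m : ℕ, TupleChain R X (m + 1) →ₗ[R] TupleChain R X m
  | 0 => linearCombination R fun v => single (Fin.tail v) 1
  | m + 1 => linearCombination R fun v =>
      single (Fin.tail v) 1 - cone (v 0) (bd m (single (Fin.tail v) 1))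

/-- The chain map induced by a map of vertices. -/
noncomputable def map (f : X → Y) (m : ℕ) : TupleChain R X m →ₗ[R] TupleChain R Y m :=
  lmapDomain R R (fun v => f ∘ v)

@[simp] lemma cone_single (a : X) {m : ℕ} (v : Fin m → X) (c : R) :
    cone a (single v c) = single (Fin.cons a v : Fin (m + 1) → X) c := by
  simp [cone]

@[simp] lemma map_single (f : X → Y) {m : ℕ} (v : Fin m → X) (c : R) :
    map f m (single v c) = single (f ∘ v) c := by
  simp [map]

lemma bd_cone_zero (a : X) (u : TupleChain R X 0) : bd 0 (cone a u) = u := by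
  induction u using Finsupp.induction_linear with
  | zero => simp
  | add f g hf hg => simp [hf, hg]
  | single v c => simp [bd]

lemma bd_cone (a : X) {m : ℕ} (u : TupleChain R X (m + 1)) :
    bd (m + 1) (cone a u) = u - cone a (bd m u) := by
  induction u using Finsupp.induction_linear with
  | zero => simp
  | add f g hf hg => simp only [map_add, hf, hg]; abel
  | single v c =>
    rw [cone_single, bd, linearCombination_single, Fin.tail_cons, Fin.cons_zero, smul_sub,
      ← map_smul, ← map_smul]
    simp

lemma bd_bd (m : ℕ) (u : TupleChain R X (m + 2)) : bd m (bd (m + 1) u) = 0 := by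
  induction m with
  | zero =>
    induction u using Finsupp.induction_linear with
    | zero => simp
    | add f g hf hg => simp [hf, hg]
    | single v c =>
      rw [← Fin.cons_self_tail v, ← cone_single, bd_cone, map_sub, bd_cone_zero, sub_self]
  | succ m ih =>
    induction u using Finsupp.induction_linear with
    | zero => simp
    | add f g hf hg => simp [hf, hg]
    | single v c =>
      rw [← Fin.cons_self_tail v, ← cone_single, bd_cone, map_sub, bd_cone, ih, map_zero,
        sub_zero, sub_self]

lemma map_cone (f : X → Y) (a : X) {m : ℕ} (u : TupleChain R X m) :
    map f (m + 1) (cone a u) = cone (f a) (map f m u) := by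
  induction u using Finsupp.induction_linear with
  | zero => simp
  | add f g hf hg => simp [hf, hg]
  | single v c =>
    simp only [cone_single, map_single]
    congr 1
    ext i
    refine Fin.cases ?_ (fun i => ?_) i <;> simp

lemma bd_map (f : X → Y) (m : ℕ) (u : TupleChain R X (m + 1)) :
    bd m (map f (m + 1) u) = map f m (bd m u) := by
  induction m with
  | zero =>
    induction u using Finsupp.induction_linear with
    | zero => simp
    | add f g hf hg => simp [hf, hg]
    | single v c =>
      rw [← Fin.cons_self_tail v, ← cone_single, map_cone, bd_cone_zero, bd_cone_zero]
  | succ m ih =>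
    induction u using Finsupp.induction_linear with
    | zero => simp
    | add f g hf hg => simp [hf, hg]
    | single v c =>
      rw [← Fin.cons_self_tail v, ← cone_single, map_cone, bd_cone, bd_cone, ih, map_sub,
        map_cone]

/-- Chains all of whose tuples have their entries in `S`. -/
abbrev chainsIn (R : Type*) [CommRing R] (S : Set X) (m : ℕ) : Submodule R (TupleChain R X m) :=
  supported R R {v | ∀ i, v i ∈ S}

lemma single_mem_chainsIn {S : Set X} {m : ℕ} {v : Fin m → X} (hv : ∀ i, v i ∈ S) (c : R) :
    single v c ∈ chainsIn R S m :=
  single_mem_supported R c hv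

lemma supported_induction {α M : Type*} [AddCommGroup M] [Module R M] {s : Set α}
    (A : (α →₀ R) →ₗ[R] M) (N : Submodule R M) (h : ∀ a ∈ s, A (single a 1) ∈ N)
    {c : α →₀ R} (hc : c ∈ supported R R s) : A c ∈ N := by
  have : supported R R s ≤ N.comap A := by
    rw [supported_eq_span_single, Submodule.span_le]
    rintro _ ⟨a, ha, rfl⟩
    exact h a ha
  exact this hc

lemma cone_mem_chainsIn {S : Set X} {a : X} (ha : a ∈ S) {m : ℕ} {u : TupleChain R X m}
    (hu : u ∈ chainsIn R S m) : cone a u ∈ chainsIn R S (m + 1) := by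
  refine supported_induction _ _ (fun v hv => ?_) hu
  rw [cone_single]
  exact single_mem_chainsIn (Fin.cases ha hv) 1

lemma bd_single_mem {m : ℕ} (v : Fin (m + 1) → X) (c : R) :
    bd m (single v c) ∈ supported R R {u : Fin m → X | Set.range u ⊆ Set.range v} := by
  have key : ∀ S : Set X, (∀ i, v i ∈ S) → bd m (single v c) ∈ chainsIn R S m := by
    intro S hv
    induction m with
    | zero =>
      rw [← Fin.cons_self_tail v, ← cone_single, bd_cone_zero]
      exact single_mem_chainsIn (fun i => hv i.succ) c
    | succ m ih =>
      rw [← Fin.cons_self_tail v, ← cone_single, bd_cone]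
      exact sub_mem (single_mem_chainsIn (fun i => hv i.succ) c)
        (cone_mem_chainsIn (hv 0) (ih _ fun i => hv i.succ))
  have := key (Set.range v) fun i => ⟨i, rfl⟩
  simpa only [Set.range_subset_iff] using this

/-- Two linear maps agreeing on tuples agree. -/
lemma ext_single {M : Type*} [AddCommGroup M] [Module R M] {m : ℕ}
    {A B : TupleChain R X m →ₗ[R] M} (h : ∀ v, A (single v 1) = B (single v 1)) : A = B :=
  Finsupp.lhom_ext' fun v => LinearMap.ext_ring (h v)

section Homotopy

variable (w : ∀ m : ℕ, (Fin (m + 1) → X) → Y)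
  (A B : ∀ m : ℕ, TupleChain R X m →ₗ[R] TupleChain R Y m)

/-- A chain homotopy from `B` to `A`, built by coning off with apex `w v`. -/
noncomputable def homotopy : ∀ m : ℕ, TupleChain R X m →ₗ[R] TupleChain R Y (m + 1)
  | 0 => 0
  | m + 1 => linearCombination R fun v => cone (w m v)
      (A (m + 1) (single v 1) - B (m + 1) (single v 1) - homotopy m (bd m (single v 1)))

lemma homotopy_succ_single (m : ℕ) (v : Fin (m + 1) → X) :
    homotopy w A B (m + 1) (single v 1) = cone (w m v)
      (A (m + 1) (single v 1) - B (m + 1) (single v 1)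
        - homotopy w A B m (bd m (single v 1))) := by
  rw [homotopy, linearCombination_single, one_smul]

variable {w A B}
  (hA : ∀ m u, bd m (A (m + 1) u) = A m (bd m u))
  (hB : ∀ m u, bd m (B (m + 1) u) = B m (bd m u)) (h0 : A 0 = B 0)

include hA hB h0 in
lemma bd_homotopy (m : ℕ) (u : TupleChain R X (m + 1)) :
    bd (m + 1) (homotopy w A B (m + 1) u) = A (m + 1) u - B (m + 1) u
      - homotopy w A B m (bd m u) := by
  suffices bd (m + 1) ∘ₗ homotopy w A B (m + 1) = A (m + 1) - B (m + 1)
      - homotopy w A B m ∘ₗ bd m from LinearMap.congr_fun this u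
  clear u
  induction m with
  | zero =>
    refine ext_single fun v => ?_
    simp only [LinearMap.comp_apply, LinearMap.sub_apply, homotopy_succ_single, bd_cone]
    simp only [homotopy, LinearMap.zero_apply, sub_zero, map_sub, hA, hB, h0, sub_self, map_zero]
  | succ m ih =>
    refine ext_single fun v => ?_
    have := LinearMap.congr_fun ih (bd (m + 1) (single v 1))
    simp only [LinearMap.comp_apply, LinearMap.sub_apply, bd_bd, map_zero, sub_zero] at this
    simp only [LinearMap.comp_apply, LinearMap.sub_apply, homotopy_succ_single, bd_cone, map_sub,
      this, hA, hB]
    abel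

lemma homotopy_mem {S : Set Y} (T : Set X)
    (hAS : ∀ m (v : Fin m → X), (∀ i, v i ∈ T) → A m (single v 1) ∈ chainsIn R S m)
    (hBS : ∀ m (v : Fin m → X), (∀ i, v i ∈ T) → B m (single v 1) ∈ chainsIn R S m)
    (hw : ∀ m v, (∀ i, v i ∈ T) → w m v ∈ S) {m : ℕ} {v : Fin m → X} (hv : ∀ i, v i ∈ T) :
    homotopy w A B m (single v 1) ∈ chainsIn R S (m + 1) := by
  induction m with
  | zero => simp [homotopy]
  | succ m ih =>
    rw [homotopy_succ_single]
    refine cone_mem_chainsIn (hw m v hv) (sub_mem (sub_mem (hAS _ v hv) (hBS _ v hv)) ?_)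
    refine supported_induction _ _ (fun u hu => ih fun i => ?_) (bd_single_mem v 1)
    obtain ⟨j, hj⟩ := hu ⟨i, rfl⟩
    exact hj ▸ hv j

lemma homotopy_equivariant {f : X → X} {g : Y → Y}
    (hAf : ∀ m u, A m (map f m u) = map g m (A m u))
    (hBf : ∀ m u, B m (map f m u) = map g m (B m u))
    (hw : ∀ m v, w m (f ∘ v) = g (w m v)) (m : ℕ) (u : TupleChain R X m) :
    homotopy w A B m (map f m u) = map g (m + 1) (homotopy w A B m u) := by
  suffices homotopy w A B m ∘ₗ map f m = map g (m + 1) ∘ₗ homotopy w A B m from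
    LinearMap.congr_fun this u
  clear u
  induction m with
  | zero => simp [homotopy]
  | succ m ih =>
    refine ext_single fun v => ?_
    have h1 := LinearMap.congr_fun ih (bd m (single v 1))
    simp only [LinearMap.comp_apply] at h1
    simp only [LinearMap.comp_apply, map_single, homotopy_succ_single, map_cone, map_sub, hw,
      ← hAf, ← hBf, ← h1, ← bd_map]

end Homotopy

attribute [irreducible] homotopy

section Subdivision

variable (b : ∀ m : ℕ, (Fin (m + 1) → X) → X)

/-- A chain map sending a tuple `v` to the cone with apex `b v` over the image of its boundary. -/
noncomputable def subdiv : ∀ m : ℕ, TupleChain R X m →ₗ[R] TupleChain R X m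
  | 0 => LinearMap.id
  | m + 1 => linearCombination R fun v => cone (b m v) (subdiv m (bd m (single v 1)))

lemma subdiv_succ_single (m : ℕ) (v : Fin (m + 1) → X) (c : R) :
    subdiv b (m + 1) (single v c) = cone (b m v) (subdiv b m (bd m (single v c))) := by
  rw [subdiv, linearCombination_single, ← map_smul, ← map_smul, ← map_smul, smul_single,
    smul_eq_mul, mul_one]

lemma bd_subdiv (m : ℕ) (u : TupleChain R X (m + 1)) :
    bd m (subdiv b (m + 1) u) = subdiv b m (bd m u) := by
  suffices bd m ∘ₗ subdiv b (m + 1) = subdiv (R := R) b m ∘ₗ bd m from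
    LinearMap.congr_fun this u
  clear u
  induction m with
  | zero =>
    refine ext_single fun v => ?_
    simp only [LinearMap.comp_apply, subdiv_succ_single, bd_cone_zero]
  | succ m ih =>
    refine ext_single fun v => ?_
    have := LinearMap.congr_fun ih (bd (m + 1) (single v 1))
    simp only [LinearMap.comp_apply, bd_bd, map_zero] at this
    rw [LinearMap.comp_apply, LinearMap.comp_apply, subdiv_succ_single, bd_cone, this, map_zero,
      sub_zero]

variable {b}

lemma subdiv_mem {S : Set X} (T : Set X)
    (hb : ∀ m v, (∀ i, v i ∈ T) → b m v ∈ S) {m : ℕ} {v : Fin m → X} (hv : ∀ i, v i ∈ T) :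
    subdiv b m (single v 1) ∈ chainsIn R S m := by
  induction m with
  | zero => exact single_mem_chainsIn (fun i => i.elim0) 1
  | succ m ih =>
    rw [subdiv_succ_single]
    refine cone_mem_chainsIn (hb m v hv) ?_
    refine supported_induction _ _ (fun u hu => ih fun i => ?_) (bd_single_mem v 1)
    obtain ⟨j, hj⟩ := hu ⟨i, rfl⟩
    exact hj ▸ hv j

lemma subdiv_equivariant {f : X → X} (hb : ∀ m v, b m (f ∘ v) = f (b m v)) (m : ℕ)
    (u : TupleChain R X m) : subdiv b m (map f m u) = map f m (subdiv b m u) := by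
  suffices subdiv b m ∘ₗ map f m = map f m ∘ₗ subdiv (R := R) b m from
    LinearMap.congr_fun this u
  clear u
  induction m with
  | zero => simp [subdiv]
  | succ m ih =>
    refine ext_single fun v => ?_
    have h1 := LinearMap.congr_fun ih (bd m (single v 1))
    simp only [LinearMap.comp_apply] at h1
    simp only [LinearMap.comp_apply, map_single, subdiv_succ_single, map_cone, hb, ← h1, ← bd_map]

/-- If the apices depend only on the set of labels of a tuple, then tuples with a repeated label
are killed. -/
lemma subdiv_eq_zero {I : Type*} [DecidableEq I] (φ : X → I) (β : Finset I → X)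
    (hb : ∀ m v, b m v = β (Finset.univ.image (φ ∘ v))) {m : ℕ} (v : Fin m → X)
    (hv : (Finset.univ.image (φ ∘ v)).card < m) (c : R) : subdiv b m (single v c) = 0 := by
  induction m generalizing c with
  | zero => simp at hv
  | succ m ih =>
    obtain _ | m := m
    · simp at hv
    rw [subdiv_succ_single]
    set S := Finset.univ.image (φ ∘ v) with hS
    set u := bd (m + 1) (single v c) with hu
    let P : (Fin (m + 1) → X) → Prop := fun t => Finset.univ.image (φ ∘ t) = S
    classical
    have hsub : ∀ t ∈ u.support, Finset.univ.image (φ ∘ t) ⊆ S := by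
      intro t ht
      have h1 : Set.range t ⊆ Set.range v :=
        (mem_supported R u).1 (bd_single_mem v c) ht
      intro x hx
      obtain ⟨i, -, rfl⟩ := Finset.mem_image.1 hx
      obtain ⟨j, hj⟩ := h1 ⟨i, rfl⟩
      exact Finset.mem_image.2 ⟨j, Finset.mem_univ _, by simp [hj]⟩
    have h1 : subdiv b (m + 1) u = subdiv b (m + 1) (u.filter P) := by
      rw [← sub_eq_zero, ← map_sub]
      have : u - u.filter P = u.filter fun t => ¬ P t := by
        exact sub_eq_iff_eq_add.2 ((add_comm _ _).trans (filter_add_filter_not u P)).symm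
      rw [this]
      have hmem : u.filter (fun t => ¬ P t) ∈
          supported R R {t : Fin (m + 1) → X | (Finset.univ.image (φ ∘ t)).card < m + 1} := by
        rw [mem_supported]
        intro t ht
        simp only [Finset.mem_coe, support_filter, Finset.mem_filter] at ht
        have := Finset.card_lt_card ((hsub t ht.1).ssubset_of_ne ht.2)
        simp only [Set.mem_ofPred_eq]
        omega
      simpa using supported_induction (subdiv b (m + 1)) ⊥ (fun t ht => by simp [ih t ht]) hmem
    have h2 : subdiv b (m + 1) (u.filter P) = cone (β S) (subdiv b m (bd m (u.filter P))) := by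
      have hmem : u.filter P ∈ supported R R {t | P t} := by
        rw [mem_supported]
        intro t ht
        simp only [Finset.mem_coe, support_filter, Finset.mem_filter] at ht
        exact ht.2
      have := supported_induction
        (subdiv b (m + 1) - cone (β S) ∘ₗ subdiv b m ∘ₗ bd m) ⊥ (fun t ht => by
          have ht : Finset.univ.image (φ ∘ t) = S := ht
          simp only [LinearMap.sub_apply, LinearMap.comp_apply, subdiv_succ_single, hb, ht,
            sub_self, Submodule.zero_mem]) hmem
      simpa [sub_eq_zero] using this
    have h3 : subdiv b m (bd m (u.filter P)) = 0 := by
      rw [← bd_subdiv, ← h1, bd_subdiv, hu, bd_bd, map_zero]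
    rw [h1, h2, h3, map_zero, map_zero]

lemma bd_homotopy_subdiv (w : ∀ m : ℕ, (Fin (m + 1) → X) → X)
    (b : ∀ m : ℕ, (Fin (m + 1) → X) → X) (m : ℕ) (u : TupleChain R X (m + 1)) :
    bd (m + 1) (homotopy w (fun _ => LinearMap.id) (subdiv b) (m + 1) u) =
      u - subdiv b (m + 1) u - homotopy w (fun _ => LinearMap.id) (subdiv b) m (bd m u) := by
  have h0 : (LinearMap.id : TupleChain R X 0 →ₗ[R] _) = subdiv b 0 := rfl
  exact bd_homotopy (w := w) (A := fun _ => LinearMap.id) (B := subdiv b) (fun _ _ => rfl)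
    (bd_subdiv b) h0 m u

end Subdivision

end TupleChain

section CyclicPermutation

open Finsupp

variable {p : ℕ} [Fact p.Prime] {B : Type*} (h : Equiv.Perm B)

lemma perm_apply_inv (b : B) : h (h⁻¹ b) = b := h.apply_symm_apply b

lemma perm_inv_apply (b : B) : h⁻¹ (h b) = b := h.symm_apply_apply b

/-- A permutation of prime order `p` admits an equivariant `ZMod p`-valued label off its fixed
points. -/
lemma exists_equivariant_label (hp : h ^ p = 1) :
    ∃ θ : B → ZMod p, ∀ b, h b ≠ b → θ (h b) = θ b + 1 := by
  let s := Equiv.Perm.SameCycle.setoid h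
  let r : B → B := fun b => (Quotient.mk s b).out
  have hr : ∀ b, ∃ i : ℤ, (h ^ i) (r b) = b := fun b => Quotient.mk_out (s := s) b
  have hrh : ∀ b, r (h b) = r b := fun b => by
    have : Quotient.mk s (h b) = Quotient.mk s b :=
      Quotient.sound (s := s) (Equiv.Perm.sameCycle_apply_left.2 (Equiv.Perm.SameCycle.refl h b))
    simp only [r, this]
  choose i hi using hr
  refine ⟨fun b => (i b : ZMod p), fun b hb => ?_⟩
  by_contra hne
  set k : ℤ := i (h b) - (i b + 1) with hk
  have hkr : (h ^ k) (r b) = r b := by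
    have h1 := hi (h b)
    rw [hrh] at h1
    have h2 : (h ^ (i b + 1)) (r b) = h b := by
      rw [add_comm, zpow_add, Equiv.Perm.mul_apply, hi b, zpow_one]
    rw [hk, sub_eq_neg_add, zpow_add, Equiv.Perm.mul_apply, h1, ← h2, ← Equiv.Perm.mul_apply,
      ← zpow_add, neg_add_cancel, zpow_zero, Equiv.Perm.one_apply]
  have hcop : IsCoprime k (p : ℤ) := by
    rw [isCoprime_comm, Prime.coprime_iff_not_dvd (Nat.prime_iff_prime_int.1 Fact.out),
      ← ZMod.intCast_zmod_eq_zero_iff_dvd]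
    intro h0
    apply hne
    rw [hk] at h0
    push_cast at h0
    exact sub_eq_zero.1 h0
  obtain ⟨u, v, huv⟩ := hcop
  have hfix : h (r b) = r b := by
    have h1 : h = (h ^ k) ^ u := by
      rw [← zpow_mul, mul_comm]
      conv_lhs => rw [← zpow_one h, ← huv, zpow_add, mul_comm v, zpow_mul h (p : ℤ), zpow_natCast,
        hp, one_zpow, mul_one]
    rw [h1]
    exact Equiv.Perm.zpow_apply_eq_self_of_apply_eq_self hkr u
  apply hb
  calc h b = h ((h ^ i b) (r b)) := by rw [hi b]
    _ = (h ^ i b) (h (r b)) := by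
      rw [← Equiv.Perm.mul_apply, ← Equiv.Perm.mul_apply, ← zpow_one_add, ← zpow_add_one,
        add_comm]
    _ = b := by rw [hfix, hi b]

/-- Equivariant choice for a permutation of prime order. -/
lemma exists_equivariant_choice {A : Type*} {h : Equiv.Perm B} (hp : h ^ p = 1) (g : Equiv.Perm A)
    (hg : g ^ p = 1) (Q : B → A → Prop) (hQ : ∀ b a, Q b a → Q (h b) (g a))
    (hex : ∀ b, ∃ a, Q b a ∧ (h b = b → g a = a)) :
    ∃ β : B → A, (∀ b, Q b (β b)) ∧ ∀ b, β (h b) = g (β b) := by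
  obtain ⟨θ, hθ⟩ := exists_equivariant_label (p := p) h hp
  choose y hy hyfix using hex
  have hQn : ∀ (n : ℕ) b a, Q b a → Q ((h ^ n) b) ((g ^ n) a) := by
    intro n
    induction n with
    | zero => intro b a hba; simpa using hba
    | succ n ih => intro b a hba; rw [pow_succ', pow_succ']; exact hQ _ _ (ih b a hba)
  classical
  refine ⟨fun b => (g ^ (θ b).val) (y ((h ^ (θ b).val)⁻¹ b)), fun b => ?_, fun b => ?_⟩
  · have := hQn (θ b).val _ _ (hy ((h ^ (θ b).val)⁻¹ b))
    rwa [perm_apply_inv] at this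
  · by_cases hb : h b = b
    · have hbn : ∀ n : ℕ, (h ^ n)⁻¹ b = b := fun n => by
        rw [Equiv.Perm.inv_eq_iff_eq]
        exact (Equiv.Perm.pow_apply_eq_self_of_apply_eq_self hb n).symm
      have hgn : ∀ n : ℕ, (g ^ n) (y b) = y b := fun n =>
        Equiv.Perm.pow_apply_eq_self_of_apply_eq_self (hyfix b hb) n
      simp only [hb, hbn, hgn, hyfix b hb]
    · have hmod : (θ (h b)).val ≡ (θ b).val + 1 [MOD p] := by
        rw [← ZMod.natCast_eq_natCast_iff]
        push_cast
        rw [ZMod.natCast_zmod_val, ZMod.natCast_zmod_val, hθ b hb]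
      have h1 : h ^ (θ (h b)).val = h ^ ((θ b).val + 1) := by
        rw [pow_eq_pow_mod _ hp, hmod, ← pow_eq_pow_mod _ hp]
      have h2 : g ^ (θ (h b)).val = g ^ ((θ b).val + 1) := by
        rw [pow_eq_pow_mod _ hg, hmod, ← pow_eq_pow_mod _ hg]
      have h3 : (h ^ ((θ b).val + 1))⁻¹ (h b) = (h ^ (θ b).val)⁻¹ b := by
        rw [pow_succ', mul_inv_rev, Equiv.Perm.mul_apply, perm_inv_apply]
      simp only [h1, h2, h3]
      rw [pow_succ', Equiv.Perm.mul_apply]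

/-- The operators `1 - h` (for `false`) and `1 + h + ⋯ + h ^ (p - 1)` (for `true`) on the free
`ZMod p`-module on `B`. -/
noncomputable def smithOp (p : ℕ) {B : Type*} (h : Equiv.Perm B) :
    Bool → Module.End (ZMod p) (B →₀ ZMod p)
  | false => 1 - lmapDomain (ZMod p) (ZMod p) h
  | true => ∑ i ∈ Finset.range p, (lmapDomain (ZMod p) (ZMod p) h : Module.End _ _) ^ i

variable {h}

lemma lmapDomain_pow_apply (c : B →₀ ZMod p) (i : ℕ) (b : B) :
    (((lmapDomain (ZMod p) (ZMod p) h : Module.End _ _) ^ i) c) b = c ((h ^ i)⁻¹ b) := by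
  induction i generalizing b with
  | zero => simp
  | succ i ih =>
    rw [pow_succ', Module.End.mul_apply, lmapDomain_apply, ← perm_apply_inv h b,
      mapDomain_apply h.injective, ih, pow_succ', mul_inv_rev, Equiv.Perm.mul_apply,
      perm_apply_inv h]

lemma smithOp_false_apply (c : B →₀ ZMod p) (b : B) :
    smithOp p h false c b = c b - c (h⁻¹ b) := by
  have := lmapDomain_pow_apply (h := h) c 1 b
  simp only [pow_one] at this
  simp only [smithOp, LinearMap.sub_apply, Module.End.one_apply, Finsupp.sub_apply, this]

lemma smithOp_true_apply (c : B →₀ ZMod p) (b : B) :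
    smithOp p h true c b = ∑ i ∈ Finset.range p, c ((h ^ i)⁻¹ b) := by
  simp only [smithOp, LinearMap.sum_apply, Finsupp.finsetSum_apply, lmapDomain_pow_apply]

lemma lmapDomain_pow_mem {S : Set B} (hS : ∀ b ∈ S, h b ∈ S) {c : B →₀ ZMod p}
    (hc : c ∈ supported (ZMod p) (ZMod p) S) (i : ℕ) :
    ((lmapDomain (ZMod p) (ZMod p) h : Module.End _ _) ^ i) c ∈ supported (ZMod p) (ZMod p) S := by
  induction i with
  | zero => simpa using hc
  | succ i ih =>
    rw [pow_succ', Module.End.mul_apply]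
    refine TupleChain.supported_induction _ _ (fun b hb => ?_) ih
    rw [lmapDomain_apply, mapDomain_single]
    exact single_mem_supported _ _ (hS b hb)

lemma smithOp_mem {S : Set B} (hS : ∀ b ∈ S, h b ∈ S) (t : Bool) {c : B →₀ ZMod p}
    (hc : c ∈ supported (ZMod p) (ZMod p) S) :
    smithOp p h t c ∈ supported (ZMod p) (ZMod p) S := by
  cases t with
  | false => simpa [smithOp] using sub_mem hc (lmapDomain_pow_mem hS hc 1)
  | true =>
    rw [smithOp, LinearMap.sum_apply]
    exact sum_mem fun i _ => lmapDomain_pow_mem hS hc i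

lemma smithOp_apply_of_fixed (t : Bool) (c : B →₀ ZMod p) {b : B} (hb : h b = b) :
    smithOp p h t c b = 0 := by
  have hbn : ∀ n : ℕ, (h ^ n)⁻¹ b = b := fun n => by
    rw [Equiv.Perm.inv_eq_iff_eq]
    exact (Equiv.Perm.pow_apply_eq_self_of_apply_eq_self hb n).symm
  cases t with
  | false =>
    have := hbn 1
    rw [pow_one] at this
    rw [smithOp_false_apply, this, sub_self]
  | true => simp [smithOp_true_apply, hbn]

lemma smithOp_eq_zero_of_fixed (t : Bool) {c : B →₀ ZMod p}
    (hc : c ∈ supported (ZMod p) (ZMod p) {b | h b = b}) : smithOp p h t c = 0 := by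
  have key : ∀ b, h b = b → smithOp p h t (single b 1) = 0 := by
    intro b hb
    have h1 : single b (1 : ZMod p) ∈ supported (ZMod p) (ZMod p) {b} :=
      single_mem_supported _ _ rfl
    have h2 := smithOp_mem (h := h) (by simpa using hb) t h1
    rw [mem_supported'] at h2
    ext x
    by_cases hx : x = b
    · rw [hx, smithOp_apply_of_fixed t _ hb, coe_zero, Pi.zero_apply]
    · exact h2 x hx
  simpa using TupleChain.supported_induction (smithOp p h t) ⊥ (fun b hb => by simpa using key b hb)
    hc

lemma smithOp_smithOp_not (hp : h ^ p = 1) (t : Bool) (c : B →₀ ZMod p) :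
    smithOp p h t (smithOp p h (!t) c) = 0 := by
  let γ : Module.End (ZMod p) (B →₀ ZMod p) := lmapDomain (ZMod p) (ZMod p) h
  have hγ : γ ^ p = 1 := by
    ext1 b
    ext1
    ext x
    simp [γ, lmapDomain_pow_apply, hp]
  suffices smithOp p h t * smithOp p h (!t) = 0 from LinearMap.congr_fun this c
  cases t with
  | false => exact (mul_neg_geom_sum γ p).trans (by rw [hγ, sub_self])
  | true => exact (geom_sum_mul_neg γ p).trans (by rw [hγ, sub_self])

lemma smithOp_comm {B' : Type*} {h' : Equiv.Perm B'} (A : (B →₀ ZMod p) →ₗ[ZMod p] (B' →₀ ZMod p))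
    (hA : ∀ c, A (mapDomain h c) = mapDomain h' (A c)) (t : Bool) (c : B →₀ ZMod p) :
    A (smithOp p h t c) = smithOp p h' t (A c) := by
  have hpow : ∀ (i : ℕ) c, A (((lmapDomain (ZMod p) (ZMod p) h : Module.End _ _) ^ i) c) =
      ((lmapDomain (ZMod p) (ZMod p) h' : Module.End _ _) ^ i) (A c) := by
    intro i
    induction i with
    | zero => simp
    | succ i ih =>
      intro c
      rw [pow_succ', pow_succ', Module.End.mul_apply, Module.End.mul_apply, lmapDomain_apply, hA,
        ih, lmapDomain_apply]
  cases t with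
  | false => simp [smithOp, hA]
  | true => simp [smithOp, hpow]

/-- The kernel of each Smith operator is spanned by the image of the other one and the chains
supported on fixed points. -/
lemma exists_of_smithOp_eq_zero (hp : h ^ p = 1) (t : Bool) {S : Set B} (hS : ∀ b ∈ S, h b ∈ S)
    {c : B →₀ ZMod p} (hc : c ∈ supported (ZMod p) (ZMod p) S) (h0 : smithOp p h t c = 0) :
    ∃ e ∈ supported (ZMod p) (ZMod p) S, ∃ f ∈ supported (ZMod p) (ZMod p) S,
      f ∈ supported (ZMod p) (ZMod p) {b | h b = b} ∧ c = smithOp p h (!t) e + f := by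
  classical
  obtain ⟨θ, hθ⟩ := exists_equivariant_label (p := p) h hp
  have hfilter : ∀ (P : B → Prop) [DecidablePred P] {d : B →₀ ZMod p},
      d ∈ supported (ZMod p) (ZMod p) S →
      d.filter P ∈ supported (ZMod p) (ZMod p) S := by
    intro P _ d hd
    rw [mem_supported'] at hd ⊢
    intro b hb
    by_cases hP : P b <;> simp [hP, hd b hb]
  have hfilter' : c.filter (fun b => h b = b) ∈ supported (ZMod p) (ZMod p) {b | h b = b} := by
    rw [mem_supported']
    intro b hb
    exact filter_apply_neg _ _ hb
  have hff : ∀ b, h b = b → c.filter (fun b => h b = b) b = c b := fun b hb =>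
    filter_apply_pos (fun b => h b = b) c hb
  have hfn : ∀ b, h b ≠ b → c.filter (fun b => h b = b) b = 0 := fun b hb =>
    filter_apply_neg (fun b => h b = b) c hb
  have hinv : ∀ (n : ℕ) b, h b ≠ b → h ((h ^ n)⁻¹ b) ≠ (h ^ n)⁻¹ b := by
    intro n b hb hh
    apply hb
    rwa [Equiv.Perm.eq_inv_iff_eq, ← Equiv.Perm.mul_apply (h ^ n) h, ← pow_succ, pow_succ',
      Equiv.Perm.mul_apply h, perm_apply_inv] at hh
  have hθn : ∀ (n : ℕ) b, h b ≠ b → θ ((h ^ n)⁻¹ b) = θ b - n := by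
    intro n
    induction n with
    | zero => simp
    | succ n ih =>
      intro b hb
      have h1 := hθ _ (hinv (n + 1) b hb)
      have h2 : h ((h ^ (n + 1))⁻¹ b) = (h ^ n)⁻¹ b := by
        rw [pow_succ, mul_inv_rev, Equiv.Perm.mul_apply, perm_apply_inv]
      rw [h2, ih b hb] at h1
      rw [eq_sub_of_add_eq h1.symm]
      push_cast
      ring
  cases t with
  | false =>
    refine ⟨c.filter fun b => h b ≠ b ∧ θ b = 0, hfilter _ hc, c.filter fun b => h b = b,
      hfilter _ hc, hfilter', ?_⟩
    have hc1 : ∀ (n : ℕ) b, c ((h ^ n)⁻¹ b) = c b := by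
      intro n
      induction n with
      | zero => simp
      | succ n ih =>
        intro b
        have := DFunLike.congr_fun h0 ((h ^ n)⁻¹ b)
        rw [smithOp_false_apply, coe_zero, Pi.zero_apply, sub_eq_zero, ih] at this
        rw [pow_succ, mul_inv_rev, Equiv.Perm.mul_apply, this]
    ext b
    rw [Finsupp.add_apply, Bool.not_false]
    by_cases hb : h b = b
    · rw [smithOp_apply_of_fixed _ _ hb, zero_add, hff b hb]
    · rw [hfn b hb, add_zero, smithOp_true_apply,
        Finset.sum_eq_single (θ b).val]
      · rw [filter_apply_pos, hc1]
        refine ⟨hinv _ _ hb, ?_⟩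
        rw [hθn _ _ hb, ZMod.natCast_zmod_val, sub_self]
      · intro i hi hne
        refine filter_apply_neg _ _ fun hh => hne ?_
        have := hh.2
        rw [hθn _ _ hb, sub_eq_zero] at this
        rw [this, ZMod.val_natCast_of_lt (Finset.mem_range.1 hi)]
      · intro hh
        exact absurd (Finset.mem_range.2 (ZMod.val_lt _)) hh
  | true =>
    refine ⟨∑ i ∈ Finset.range p, (((lmapDomain (ZMod p) (ZMod p) h : Module.End _ _) ^ i) c).filter
      fun b => i ≤ (θ b).val, sum_mem fun i _ => hfilter _ (lmapDomain_pow_mem hS hc i),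
      c.filter fun b => h b = b, hfilter _ hc, hfilter', ?_⟩
    ext b
    rw [Finsupp.add_apply, Bool.not_true]
    by_cases hb : h b = b
    · rw [smithOp_apply_of_fixed _ _ hb, zero_add, hff b hb]
    · rw [hfn b hb, add_zero, smithOp_false_apply]
      have he : ∀ x, (∑ i ∈ Finset.range p,
          (((lmapDomain (ZMod p) (ZMod p) h : Module.End _ _) ^ i) c).filter
            fun b => i ≤ (θ b).val) x = ∑ i ∈ Finset.range ((θ x).val + 1), c ((h ^ i)⁻¹ x) := by
        intro x
        rw [finsetSum_apply]
        simp only [filter_apply, lmapDomain_pow_apply]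
        rw [← Finset.sum_filter]
        congr 1
        ext i
        have := ZMod.val_lt (θ x)
        simp only [Finset.mem_filter, Finset.mem_range]
        omega
      have hs : ∀ i, c ((h ^ i)⁻¹ (h⁻¹ b)) = c ((h ^ (i + 1))⁻¹ b) := fun i => by
        rw [pow_succ', mul_inv_rev, Equiv.Perm.mul_apply]
      have hθ1 := hθn 1 b hb
      rw [pow_one, Nat.cast_one] at hθ1
      rw [he, he]
      simp only [hs]
      rw [hθ1, Finset.sum_range_succ']
      by_cases hz : θ b = 0
      · have hp1 : ((0 : ZMod p) - 1).val + 1 = p := by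
          obtain ⟨q, rfl⟩ := Nat.exists_eq_succ_of_ne_zero (Fact.out : p.Prime).ne_zero
          rw [zero_sub, ZMod.val_neg_one]
        have h1 : ∑ i ∈ Finset.range p, c ((h ^ (i + 1))⁻¹ b) = 0 := by
          have := DFunLike.congr_fun h0 (h⁻¹ b)
          rw [smithOp_true_apply] at this
          simp only [hs] at this
          exact this
        rw [hz, hp1, h1]
        simp
      · have h1 : (θ b - 1).val + 1 = (θ b).val := by
          have h2 : 1 ≤ (θ b).val := Nat.one_le_iff_ne_zero.2 fun h => hz ((ZMod.val_eq_zero _).1 h)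
          have h3 : (1 : ZMod p).val = 1 := ZMod.val_one p
          rw [ZMod.val_sub (h3.trans_le h2), h3]
          omega
        rw [h1]
        simp

end CyclicPermutation

section

open Finsupp Metric TupleChain

section FineChains

variable {X Y : Type*} [PseudoMetricSpace X] [PseudoMetricSpace Y] {p : ℕ}

/-- Chains of tuples with entries in `S` and mutual distances less than `δ`. -/
abbrev fineChains (p : ℕ) (S : Set X) (δ : ℝ) (m : ℕ) :
    Submodule (ZMod p) (TupleChain (ZMod p) X m) :=
  supported (ZMod p) (ZMod p) {v | (∀ i, v i ∈ S) ∧ ∀ i j, dist (v i) (v j) < δ}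

lemma fineChains_mono {S S' : Set X} (hS : S ⊆ S') {δ δ' : ℝ} (hδ : δ ≤ δ') (m : ℕ) :
    fineChains p S δ m ≤ fineChains p S' δ' m :=
  supported_mono fun _ hv => ⟨fun i => hS (hv.1 i), fun i j => (hv.2 i j).trans_le hδ⟩

lemma bd_mem_fineChains {S : Set X} {δ : ℝ} {m : ℕ} {c : TupleChain (ZMod p) X (m + 1)}
    (hc : c ∈ fineChains p S δ (m + 1)) : bd m c ∈ fineChains p S δ m := by
  refine supported_induction _ _ (fun v hv => ?_) hc
  refine supported_mono (fun u hu => ?_) (bd_single_mem v 1)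
  have h1 : ∀ i, ∃ j, v j = u i := fun i => hu ⟨i, rfl⟩
  choose j hj using h1
  exact ⟨fun i => hj i ▸ hv.1 _, fun i i' => by rw [← hj i, ← hj i']; exact hv.2 _ _⟩

lemma bd_mem_chainsIn {R X : Type*} [CommRing R] {S : Set X} {m : ℕ} {c : TupleChain R X (m + 1)}
    (hc : c ∈ chainsIn R S (m + 1)) : bd m c ∈ chainsIn R S m := by
  refine supported_induction _ _ (fun v hv => ?_) hc
  refine supported_mono (fun u hu i => ?_) (bd_single_mem v 1)
  obtain ⟨j, hj⟩ := hu ⟨i, rfl⟩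
  exact hj ▸ hv j

lemma map_mem_fineChains {S : Set X} {S' : Set Y} {δ δ' : ℝ} {f : X → Y} (hf : Set.MapsTo f S S')
    (hd : ∀ a ∈ S, ∀ b ∈ S, dist a b < δ → dist (f a) (f b) < δ') {m : ℕ}
    {c : TupleChain (ZMod p) X m} (hc : c ∈ fineChains p S δ m) :
    map f m c ∈ fineChains p S' δ' m := by
  refine supported_induction _ _ (fun v hv => ?_) hc
  rw [map_single]
  exact single_mem_supported _ _
    ⟨fun i => hf (hv.1 i), fun i j => hd _ (hv.1 i) _ (hv.1 j) (hv.2 i j)⟩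

lemma map_eq_self {R X : Type*} [CommRing R] {S : Set X} {f : X → X} (hf : ∀ a ∈ S, f a = a)
    {m : ℕ} {c : TupleChain R X m} (hc : c ∈ chainsIn R S m) : map f m c = c := by
  have := supported_induction (map f m - LinearMap.id) ⊥ (fun v hv => ?_) hc
  · simpa [sub_eq_zero] using this
  · have : f ∘ v = v := funext fun i => hf _ (hv i)
    simp [this]

lemma map_map {R X Y Z : Type*} [CommRing R] (f : X → Y) (g : Y → Z) {m : ℕ}
    (c : TupleChain R X m) : map g m (map f m c) = map (g ∘ f) m c := by
  simp only [TupleChain.map, lmapDomain_apply, ← mapDomain_comp]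
  rfl

variable (p) in
/-- Homological local connectedness at `x`, with coefficients in `ZMod p`, in terms of fine
chains. -/
def HomologicallyLC (x : X) : Prop :=
  ∀ m : ℕ, ∀ r > 0, ∃ s > 0, ∀ ε > 0, ∃ δ > 0, ∀ z ∈ fineChains p (ball x s) δ (m + 1),
    bd m z = 0 → ∃ c ∈ fineChains p (ball x r) ε (m + 2), bd (m + 1) c = z

variable (X) in
/-- A uniform version of finite-dimensionality: labels with arbitrarily small fibres such that
small finite sets carry a bounded number of labels. -/
def HasSmallLabels : Prop :=
  ∃ K : ℕ, ∀ ε > 0, ∃ δ > 0, ∃ (I : Type) (φ : X → I), (∀ a b, φ a = φ b → dist a b < ε) ∧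
    ∀ s : Finset X, (∀ a ∈ s, ∀ b ∈ s, dist a b < δ) → (φ '' s).ncard ≤ K

lemma HasSmallLabels.subtype (hX : HasSmallLabels X) (S : Set X) : HasSmallLabels S := by
  obtain ⟨K, hK⟩ := hX
  refine ⟨K, fun ε hε => ?_⟩
  obtain ⟨δ, hδ, I, φ, h1, h2⟩ := hK ε hε
  classical
  refine ⟨δ, hδ, I, fun a => φ a, fun a b hab => h1 _ _ hab, fun s hs => ?_⟩
  have := h2 (s.image Subtype.val) (by
    intro a ha b hb
    obtain ⟨a', ha', rfl⟩ := Finset.mem_image.1 ha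
    obtain ⟨b', hb', rfl⟩ := Finset.mem_image.1 hb
    exact hs a' ha' b' hb')
  rwa [Finset.coe_image, Set.image_image] at this

end FineChains

section SmithAlgebra

variable {X : Type*} {p : ℕ}

/-- The permutation of tuples induced by a permutation of vertices. -/
def tuplePerm (g : Equiv.Perm X) (m : ℕ) : Equiv.Perm (Fin m → X) :=
  Equiv.piCongrRight fun _ => g

lemma tuplePerm_apply (g : Equiv.Perm X) {m : ℕ} (v : Fin m → X) : tuplePerm g m v = g ∘ v := rfl

lemma tuplePerm_pow {g : Equiv.Perm X} (hg : g ^ p = 1) (m : ℕ) : tuplePerm g m ^ p = 1 := by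
  have : ∀ n : ℕ, ∀ v : Fin m → X, (tuplePerm g m ^ n) v = (g ^ n : Equiv.Perm X) ∘ v := by
    intro n
    induction n with
    | zero => intro v; rfl
    | succ n ih =>
      intro v
      rw [pow_succ', Equiv.Perm.mul_apply, ih, tuplePerm_apply, pow_succ']
      rfl
  ext1 v
  rw [this, hg]
  rfl

variable [Fact p.Prime]

/-- The Smith operators on chains. -/
noncomputable abbrev smith (p : ℕ) (g : Equiv.Perm X) (t : Bool) (m : ℕ) :
    Module.End (ZMod p) (TupleChain (ZMod p) X m) :=
  smithOp p (tuplePerm g m) t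

lemma smith_comm {g : Equiv.Perm X} {m n : ℕ}
    (A : TupleChain (ZMod p) X m →ₗ[ZMod p] TupleChain (ZMod p) X n)
    (hA : ∀ c, A (map g m c) = map g n (A c)) (t : Bool) (c : TupleChain (ZMod p) X m) :
    A (smith p g t m c) = smith p g t n (A c) :=
  smithOp_comm (h := tuplePerm g m) (h' := tuplePerm g n) A hA t c

lemma bd_smith (g : Equiv.Perm X) (t : Bool) (m : ℕ) (c : TupleChain (ZMod p) X (m + 1)) :
    bd m (smith p g t (m + 1) c) = smith p g t m (bd m c) :=
  smith_comm _ (fun c => bd_map g m c) t c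

variable {g : Equiv.Perm X}

lemma eq_zero_of_fixed {m : ℕ} {u w : TupleChain (ZMod p) X m} (t : Bool)
    (hw : w ∈ chainsIn (ZMod p) {y | g y = y} m) (h : smith p g t m u = w) : w = 0 := by
  ext v
  by_cases hv : ∀ i, g (v i) = v i
  · rw [← h]
    exact smithOp_apply_of_fixed t u (funext hv)
  · exact (mem_supported' _ _).1 hw v hv

lemma smith_eq_zero {m : ℕ} (t : Bool) {w : TupleChain (ZMod p) X m}
    (hw : w ∈ chainsIn (ZMod p) {y | g y = y} m) : smith p g t m w = 0 :=
  smithOp_eq_zero_of_fixed t (supported_mono (fun _ hv => funext hv) hw)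

end SmithAlgebra

section Smith

variable {X : Type*} [MetricSpace X] {p : ℕ} {g : Equiv.Perm X}

lemma tuplePerm_mem_fine (hg : Isometry g) {x : X} (hx : g x = x) {s δ : ℝ} {m : ℕ}
    (v : Fin m → X) (hv : v ∈ {v : Fin m → X | (∀ i, v i ∈ ball x s) ∧
      ∀ i j, dist (v i) (v j) < δ}) :
    tuplePerm g m v ∈ {v : Fin m → X | (∀ i, v i ∈ ball x s) ∧ ∀ i j, dist (v i) (v j) < δ} := by
  refine ⟨fun i => ?_, fun i j => ?_⟩
  · have := hv.1 i
    rw [mem_ball, ← hg.dist_eq, hx] at this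
    exact this
  · have := hv.2 i j
    rw [← hg.dist_eq] at this
    exact this

variable [Fact p.Prime]

variable (p) in
/-- Local vanishing of the special Smith homology in degree `m`. -/
def SmithVanishing (g : Equiv.Perm X) (x : X) (t : Bool) (m : ℕ) : Prop :=
  ∀ r > 0, ∃ s > 0, ∀ ε > 0, ∃ δ > 0, ∀ c ∈ fineChains p (ball x s) δ (m + 1),
    bd m (smith p g t (m + 1) c) = 0 → ∃ d ∈ fineChains p (ball x r) ε (m + 2),
      smith p g t (m + 1) c = smith p g t (m + 1) (bd (m + 1) d)

lemma SmithVanishing.split (hg : Isometry g) (hgp : g ^ p = 1) {x : X} (hx : g x = x)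
    (hL : HomologicallyLC p x) {t : Bool} {m : ℕ} (hV : SmithVanishing p g x (!t) (m + 1)) :
    ∀ r > 0, ∃ s > 0, ∀ ε > 0, ∃ δ > 0, ∀ z ∈ fineChains p (ball x s) δ (m + 1),
      bd m z = 0 → smith p g (!t) (m + 1) z = 0 →
        ∃ e, ∃ f ∈ fineChains p (ball x r) ε (m + 2),
          e ∈ fineChains p (ball x r) ε (m + 2) ∧ f ∈ chainsIn (ZMod p) {y | g y = y} (m + 2) ∧
            z = smith p g t (m + 1) (bd (m + 1) e) + bd (m + 1) f := by
  intro r hr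
  obtain ⟨s, hs, h1⟩ := hV r hr
  obtain ⟨s', hs', h2⟩ := hL m (min s r) (lt_min hs hr)
  refine ⟨s', hs', fun ε hε => ?_⟩
  obtain ⟨δ, hδ, h1⟩ := h1 ε hε
  obtain ⟨δ', hδ', h2⟩ := h2 (min δ ε) (lt_min hδ hε)
  refine ⟨δ', hδ', fun z hz hz0 hzt => ?_⟩
  obtain ⟨c, hc, hcz⟩ := h2 z hz hz0
  obtain ⟨d, hd, hcd⟩ := h1 c (fineChains_mono (ball_subset_ball (min_le_left _ _))
    (min_le_left _ _) _ hc) (by rw [bd_smith, hcz, hzt])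
  have h3 : smithOp p (tuplePerm g (m + 2)) (!t) (c - bd (m + 2) d) = 0 := by
    rw [map_sub, sub_eq_zero]
    exact hcd
  obtain ⟨e, he, f, hf, hff, hef⟩ := exists_of_smithOp_eq_zero (tuplePerm_pow hgp _) (!t)
    (tuplePerm_mem_fine hg hx) (sub_mem (fineChains_mono (ball_subset_ball (min_le_right _ _))
    (min_le_right _ _) _ hc) (bd_mem_fineChains hd)) h3
  refine ⟨e, f, hf, he, supported_mono (fun v hv i => congrFun hv i) hff, ?_⟩
  have h4 := congrArg (bd (m + 1)) hef
  rw [map_sub, bd_bd, sub_zero, hcz, map_add, Bool.not_not] at h4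
  rw [h4, ← bd_smith]

lemma SmithVanishing.pred (hg : Isometry g) (hgp : g ^ p = 1) {x : X} (hx : g x = x)
    (hL : HomologicallyLC p x) {t : Bool} {m : ℕ} (hV : SmithVanishing p g x (!t) (m + 1)) :
    SmithVanishing p g x t m := by
  intro r hr
  obtain ⟨s, hs, h1⟩ := hV.split hg hgp hx hL r hr
  refine ⟨s, hs, fun ε hε => ?_⟩
  obtain ⟨δ, hδ, h1⟩ := h1 ε hε
  refine ⟨δ, hδ, fun c hc hc0 => ?_⟩
  obtain ⟨e, f, -, he, hf, hef⟩ := h1 _ (smithOp_mem (tuplePerm_mem_fine hg hx) t hc) hc0 (by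
    have := smithOp_smithOp_not (tuplePerm_pow hgp (m + 1)) (!t) c
    rwa [Bool.not_not] at this)
  refine ⟨e, he, ?_⟩
  have h2 := eq_zero_of_fixed t (u := c - bd (m + 1) e) (bd_mem_chainsIn hf) (by
    rw [map_sub, hef, add_sub_cancel_left])
  rw [hef, h2, add_zero]

lemma SmithVanishing.fixed (hg : Isometry g) (hgp : g ^ p = 1) {x : X} (hx : g x = x)
    (hL : HomologicallyLC p x) {t : Bool} {m : ℕ} (hV : SmithVanishing p g x (!t) (m + 1)) :
    ∀ r > 0, ∃ s > 0, ∀ ε > 0, ∃ δ > 0, ∀ z ∈ fineChains p (ball x s) δ (m + 1),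
      z ∈ chainsIn (ZMod p) {y | g y = y} (m + 1) → bd m z = 0 →
        ∃ f ∈ fineChains p (ball x r) ε (m + 2),
          f ∈ chainsIn (ZMod p) {y | g y = y} (m + 2) ∧ bd (m + 1) f = z := by
  intro r hr
  obtain ⟨s, hs, h1⟩ := hV.split hg hgp hx hL r hr
  refine ⟨s, hs, fun ε hε => ?_⟩
  obtain ⟨δ, hδ, h1⟩ := h1 ε hε
  refine ⟨δ, hδ, fun z hz hzF hz0 => ?_⟩
  obtain ⟨e, f, hf, he, hff, hef⟩ := h1 z hz hz0 (smith_eq_zero _ hzF)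
  refine ⟨f, hf, hff, ?_⟩
  have h2 := eq_zero_of_fixed t (u := bd (m + 1) e) (w := z - bd (m + 1) f)
    (sub_mem hzF (bd_mem_chainsIn hff)) (by rw [hef, add_sub_cancel_right])
  exact (sub_eq_zero.1 h2).symm

omit [Fact p.Prime] in
lemma exists_fixed_near (hg : Continuous g) {x : X} {R : ℝ}
    (hR : IsCompact (closedBall x R)) {ε : ℝ} (hε : 0 < ε) :
    ∃ δ > 0, ∀ y ∈ ball x R, dist (g y) y < δ → ∃ f, g f = f ∧ dist y f < ε := by
  let C : Set X := closedBall x R ∩ ⋂ f ∈ {f | g f = f}, {y | ε ≤ dist y f}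
  have hC : IsCompact C := hR.inter_right (isClosed_biInter fun f _ =>
    isClosed_le continuous_const (continuous_id.dist continuous_const))
  have key : ∀ δ : ℝ, (∀ y ∈ C, δ ≤ dist (g y) y) →
      ∀ y ∈ ball x R, dist (g y) y < δ → ∃ f, g f = f ∧ dist y f < ε := by
    intro δ hδ y hy hyδ
    by_contra! hne
    exact absurd (hδ y ⟨ball_subset_closedBall hy, Set.mem_iInter₂.2 hne⟩) hyδ.not_ge
  obtain hE | hE := C.eq_empty_or_nonempty
  · exact ⟨1, one_pos, key 1 (by simp [hE])⟩
  · obtain ⟨y, hy, hmin⟩ := hC.exists_isMinOn hE (hg.dist continuous_id).continuousOn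
    refine ⟨dist (g y) y, dist_pos.2 fun hgy => ?_, key _ fun z hz => hmin hz⟩
    have := Set.mem_iInter₂.1 hy.2 y hgy
    simp only [Set.mem_ofPred_eq, dist_self] at this
    exact absurd hε this.not_gt

lemma HasSmallLabels.equivariant (hX : HasSmallLabels X) (hg : Isometry g) (hgp : g ^ p = 1) :
    ∃ K : ℕ, ∀ ε > 0, ∃ δ > 0, ∃ (I : Type) (φ : X → I) (ψ : Equiv.Perm I), ψ ^ p = 1 ∧
      (∀ a, φ (g a) = ψ (φ a)) ∧ (∀ a b, φ a = φ b → dist a b < ε) ∧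
        ∀ s : Finset X, (∀ a ∈ s, ∀ b ∈ s, dist a b < δ) → (φ '' s).ncard ≤ K := by
  obtain ⟨K, hK⟩ := hX
  refine ⟨K ^ p, fun ε hε => ?_⟩
  obtain ⟨δ, hδ, I, φ, h1, h2⟩ := hK ε hε
  let φ' : X → ZMod p → I := fun x i => φ ((g ^ i.val) x)
  let ψ : Equiv.Perm (ZMod p → I) := Equiv.piCongrLeft' (fun _ => I) (Equiv.addRight (-1))
  have hψ : ∀ u i, ψ u i = u (i + 1) := fun u i => by simp [ψ]
  have hψn : ∀ n : ℕ, ∀ u i, (ψ ^ n) u i = u (i + n) := by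
    intro n
    induction n with
    | zero => simp
    | succ n ih =>
      intro u i
      rw [pow_succ', Equiv.Perm.mul_apply, hψ, ih]
      push_cast
      congr 1
      ring
  have hiso : ∀ n : ℕ, Isometry (g ^ n : Equiv.Perm X) := by
    intro n
    induction n with
    | zero => exact isometry_id
    | succ n ih => rw [pow_succ']; exact hg.comp ih
  classical
  refine ⟨δ, hδ, ZMod p → I, φ', ψ, ?_, fun a => ?_, fun a b hab => ?_, fun s hs => ?_⟩
  · ext u i
    rw [hψn, CharP.cast_eq_zero, add_zero, Equiv.Perm.one_apply]
  · ext i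
    rw [hψ]
    have hmod : (i + 1).val ≡ i.val + 1 [MOD p] := by
      rw [← ZMod.natCast_eq_natCast_iff]
      simp
    have : g ^ (i + 1).val = g ^ (i.val + 1) := by
      rw [pow_eq_pow_mod _ hgp, hmod, ← pow_eq_pow_mod _ hgp]
    simp only [φ', this, pow_succ, Equiv.Perm.mul_apply]
  · have := congrFun hab 0
    simp only [φ', ZMod.val_zero, pow_zero, Equiv.Perm.one_apply] at this
    exact h1 a b this
  · have hsub : s.image φ' ⊆ Fintype.piFinset fun i : ZMod p =>
        (s.image (g ^ i.val : Equiv.Perm X)).image φ := by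
      intro u hu
      obtain ⟨a, ha, rfl⟩ := Finset.mem_image.1 hu
      exact Fintype.mem_piFinset.2 fun i =>
        Finset.mem_image_of_mem _ (Finset.mem_image_of_mem _ ha)
    rw [← Finset.coe_image, Set.ncard_coe_finset]
    refine (Finset.card_le_card hsub).trans ?_
    rw [Fintype.card_piFinset]
    refine (Finset.prod_le_pow_card _ _ K fun i _ => ?_).trans_eq
      (by rw [Finset.card_univ, ZMod.card])
    rw [← Set.ncard_coe_finset, Finset.coe_image]
    refine h2 _ fun a ha b hb => ?_
    obtain ⟨a', ha', rfl⟩ := Finset.mem_image.1 ha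
    obtain ⟨b', hb', rfl⟩ := Finset.mem_image.1 hb
    rw [(hiso i.val).dist_eq]
    exact hs a' ha' b' hb'

lemma finsetCongr_pow {I : Type*} (ψ : Equiv.Perm I) (n : ℕ) (S : Finset I) :
    ((ψ.finsetCongr : Equiv.Perm (Finset I)) ^ n) S = S.map (ψ ^ n : Equiv.Perm I).toEmbedding := by
  induction n with
  | zero => exact Finset.map_refl.symm
  | succ n ih =>
    rw [pow_succ', Equiv.Perm.mul_apply, ih, pow_succ']
    exact Finset.map_map _ _ _

open Classical in
/-- The finite set of labels of the entries of a tuple. -/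
noncomputable def tupleLabels {I : Type*} (φ : X → I) {n : ℕ} (v : Fin n → X) : Finset I :=
  Finset.univ.image (φ ∘ v)

omit [MetricSpace X] in
lemma tupleLabels_comp {I : Type*} {φ : X → I} {ψ : Equiv.Perm I} (h : ∀ a, φ (g a) = ψ (φ a))
    {n : ℕ} (v : Fin n → X) :
    tupleLabels φ (g ∘ v) = (tupleLabels φ v).map ψ.toEmbedding := by
  classical
  have : φ ∘ g ∘ v = ψ ∘ φ ∘ v := funext fun i => h (v i)
  simp only [tupleLabels, this, Finset.map_eq_image, Finset.image_image]
  rfl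

omit [MetricSpace X] in
lemma mem_tupleLabels {I : Type*} (φ : X → I) {n : ℕ} (v : Fin n → X) (i : Fin n) :
    φ (v i) ∈ tupleLabels φ v := by
  classical
  exact Finset.mem_image_of_mem (φ ∘ v) (Finset.mem_univ i)

omit [MetricSpace X] in
lemma exists_of_mem_tupleLabels {I : Type*} {φ : X → I} {n : ℕ} {v : Fin n → X} {c : I}
    (h : c ∈ tupleLabels φ v) : ∃ i, φ (v i) = c := by
  classical
  obtain ⟨i, -, hi⟩ := Finset.mem_image.1 h
  exact ⟨i, hi⟩

lemma exists_equivariant_apex (hg : Isometry g) (hgp : g ^ p = 1) {x : X} (hx : g x = x)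
    {s η κ δ : ℝ} (hκη : κ ≤ η / 2) (hδκ : δ ≤ κ / 2)
    (hfix : ∀ y ∈ ball x s, dist (g y) y < κ → ∃ f, g f = f ∧ dist y f < η / 2)
    {I : Type*} {φ : X → I} {ψ : Equiv.Perm I} (hψ : ψ ^ p = 1) (hφψ : ∀ a, φ (g a) = ψ (φ a))
    (hφ : ∀ a b, φ a = φ b → dist a b < κ / 2) :
    ∃ β : Finset I → X, (∀ n, ∀ v : Fin (n + 1) → X, (∀ i, v i ∈ ball x s) →
      (∀ i j, dist (v i) (v j) < δ) → ∀ i, dist (v i) (β (tupleLabels φ v)) < η) ∧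
      ∀ S, β (S.map ψ.toEmbedding) = g (β S) := by
  have hginv : ∀ y, g (g.symm y) = y := g.apply_symm_apply
  let h : Equiv.Perm (Finset I) := ψ.finsetCongr
  have hhp : h ^ p = 1 := by
    ext1 S
    rw [finsetCongr_pow, hψ]
    exact Finset.map_refl
  obtain ⟨β, hβ, hβg⟩ := exists_equivariant_choice (p := p) hhp g hgp
    (fun S y => ∀ n, ∀ v : Fin (n + 1) → X, (∀ i, v i ∈ ball x s) →
      (∀ i j, dist (v i) (v j) < δ) → tupleLabels φ v = S → ∀ i, dist (v i) y < η)
    (by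
      intro S y hy n v hv hv' hvS i
      have h1 : tupleLabels φ (g.symm ∘ v) = S := by
        have h2 := tupleLabels_comp hφψ (g.symm ∘ v)
        have h3 : g ∘ g.symm ∘ v = v := funext fun i => hginv (v i)
        rw [h3, hvS] at h2
        exact (h.injective h2).symm
      have := hy n (g.symm ∘ v) (fun i => ?_) (fun i j => ?_) h1 i
      · rw [← hg.dist_eq, Function.comp_apply, hginv] at this
        exact this
      · have := hv i
        rw [mem_ball, ← hginv (v i), ← hx, hg.dist_eq] at this
        exact this
      · have := hv' i j
        rw [← hginv (v i), ← hginv (v j), hg.dist_eq] at this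
        exact this)
    (by
      intro S
      by_cases hS : ∃ n, ∃ v : Fin (n + 1) → X, (∀ i, v i ∈ ball x s) ∧
        (∀ i j, dist (v i) (v j) < δ) ∧ tupleLabels φ v = S
      · obtain ⟨n, v, hv, hv', hvS⟩ := hS
        have hnear : ∀ a, φ a ∈ S → dist a (v 0) < κ := by
          intro a ha
          rw [← hvS] at ha
          obtain ⟨j, hj⟩ := exists_of_mem_tupleLabels ha
          have h1 := hφ _ _ hj
          have h2 := hv' j 0
          have h3 := dist_triangle a (v j) (v 0)
          rw [dist_comm] at h1
          linarith
        by_cases hSS : h S = S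
        · have h1 : dist (g (v 0)) (v 0) < κ := by
            refine hnear _ ?_
            rw [hφψ, ← hSS, ← hvS]
            exact Finset.mem_map_of_mem ψ.toEmbedding (mem_tupleLabels φ v 0)
          obtain ⟨f, hf, hvf⟩ := hfix (v 0) (hv 0) h1
          refine ⟨f, fun n w hw hw' hwS i => ?_, fun _ => hf⟩
          have h2 := hnear _ (hwS ▸ mem_tupleLabels φ w i)
          have h3 := dist_triangle (w i) (v 0) f
          linarith
        · refine ⟨v 0, fun n w hw hw' hwS i => ?_, fun h' => absurd h' hSS⟩
          have h2 := hnear _ (hwS ▸ mem_tupleLabels φ w i)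
          linarith [dist_nonneg (x := w i) (y := v 0)]
      · exact ⟨x, fun n v hv hv' hvS => absurd ⟨n, v, hv, hv', hvS⟩ hS, fun _ => hx⟩)
  exact ⟨β, fun n v hv hv' => hβ _ n v hv hv' rfl, fun S => hβg S⟩

lemma smithVanishing_of_le (hX : HasSmallLabels X) (hg : Isometry g) (hgp : g ^ p = 1) {x : X}
    (hx : g x = x) {R : ℝ} (hR0 : 0 < R) (hR : IsCompact (closedBall x R)) :
    ∃ K, ∀ m ≥ K, ∀ t, SmithVanishing p g x t m := by
  obtain ⟨K, hK⟩ := hX.equivariant hg hgp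
  refine ⟨K, fun m hm t r hr => ⟨min r R / 2, half_pos (lt_min hr hR0), fun ε hε => ?_⟩⟩
  have hs0 : 0 < min r R / 2 := half_pos (lt_min hr hR0)
  have hsr : min r R / 2 ≤ r / 2 := by linarith [min_le_left r R]
  have hsR : min r R / 2 ≤ R / 2 := by linarith [min_le_right r R]
  generalize min r R / 2 = s at hs0 hsr hsR ⊢
  obtain ⟨η, hη0, hηε, hηs⟩ : ∃ η, 0 < η ∧ η ≤ ε / 4 ∧ η ≤ s :=
    ⟨min (ε / 4) s, lt_min (by linarith) hs0, min_le_left _ _, min_le_right _ _⟩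
  obtain ⟨δ₁, hδ₁, hfix⟩ := exists_fixed_near hg.continuous hR (half_pos hη0)
  obtain ⟨κ, hκ0, hκη, hκδ⟩ : ∃ κ, 0 < κ ∧ κ ≤ η / 2 ∧ κ ≤ δ₁ :=
    ⟨min (η / 2) δ₁, lt_min (half_pos hη0) hδ₁, min_le_left _ _, min_le_right _ _⟩
  obtain ⟨δ₂, hδ₂, I, φ, ψ, hψ, hφψ, hφ, hcard⟩ := hK (κ / 2) (half_pos hκ0)
  obtain ⟨δ, hδ0, hδδ, hδκ⟩ : ∃ δ, 0 < δ ∧ δ ≤ δ₂ ∧ δ ≤ κ / 2 :=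
    ⟨min δ₂ (κ / 2), lt_min hδ₂ (half_pos hκ0), min_le_left _ _, min_le_right _ _⟩
  obtain ⟨β, hβ, hβg⟩ := exists_equivariant_apex (p := p) (s := s) hg hgp hx hκη hδκ
    (fun y hy hgy => hfix y (ball_subset_ball (by linarith) hy) (hgy.trans_le hκδ)) hψ hφψ hφ
  obtain ⟨b, hb⟩ : ∃ b : ∀ n, (Fin (n + 1) → X) → X, ∀ n v, b n v = β (tupleLabels φ v) :=
    ⟨fun n v => β (tupleLabels φ v), fun _ _ => rfl⟩
  have hbg : ∀ n v, b n (g ∘ v) = g (b n v) := fun n v => by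
    rw [hb, hb, tupleLabels_comp hφψ, hβg]
  let H : ∀ n, TupleChain (ZMod p) X n →ₗ[ZMod p] TupleChain (ZMod p) X (n + 1) :=
    homotopy (fun n v => v 0) (fun n => LinearMap.id) (subdiv b)
  have hH : ∀ u, bd (m + 1) (H (m + 1) u) = u - subdiv b (m + 1) u - H m (bd m u) := fun u =>
    bd_homotopy_subdiv _ b m u
  have hHg : ∀ n u, H n (map g n u) = map g (n + 1) (H n u) :=
    homotopy_equivariant (fun _ _ => rfl) (subdiv_equivariant hbg) (fun _ _ => rfl)
  have hHF : ∀ v : Fin (m + 1) → X, ((∀ i, v i ∈ ball x s) ∧ ∀ i j, dist (v i) (v j) < δ) →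
      H (m + 1) (single v 1) ∈ fineChains p (ball x r) ε (m + 2) := by
    intro v hv
    have hY : H (m + 1) (single v 1) ∈
        chainsIn (ZMod p) (ball (v 0) (ε / 2) ∩ ball x r) (m + 2) := by
      have hv0 : ∀ y ∈ Set.range v, y ∈ ball (v 0) (ε / 2) ∩ ball x r := by
        rintro _ ⟨i, rfl⟩
        refine ⟨?_, ball_subset_ball (by linarith) (hv.1 i)⟩
        rw [mem_ball]
        linarith [hv.2 i 0]
      refine homotopy_mem (Set.range v) (fun n u hu => ?_) (fun n u hu => ?_) (fun n u hu => ?_)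
        (fun i => ⟨i, rfl⟩)
      · exact single_mem_chainsIn (fun i => hv0 _ (hu i)) 1
      · refine subdiv_mem (Set.range v) (fun n u hu => ?_) hu
        have h1 : dist (u 0) (b n u) < η := by
          rw [hb]
          choose j hj using hu
          refine hβ n u (fun i => (hj i ▸ hv.1 (j i) : u i ∈ ball x s)) (fun i i' => ?_) 0
          rw [← hj i, ← hj i']
          exact hv.2 _ _
        obtain ⟨j, hj⟩ := hu 0
        have h2 := hv.2 j 0
        have h3 := hv.1 j
        rw [hj] at h2 h3
        rw [mem_ball] at h3
        have h4 := dist_triangle_left (b n u) (v 0) (u 0)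
        have h5 := dist_triangle_left (b n u) x (u 0)
        refine ⟨?_, ?_⟩ <;> rw [mem_ball] <;> linarith
      · exact hv0 _ (hu 0)
    rw [mem_supported] at hY ⊢
    refine fun u hu => ⟨fun i => (hY hu i).2, fun i j => ?_⟩
    have h1 := (hY hu i).1
    have h2 := (hY hu j).1
    rw [mem_ball] at h1 h2
    linarith [dist_triangle_right (u i) (u j) (v 0)]
  refine ⟨δ, hδ0, fun c hc hc0 => ⟨H (m + 1) c, supported_induction _ _ hHF hc, ?_⟩⟩
  have hT : subdiv b (m + 1) c = 0 := by
    classical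
    have : subdiv b (m + 1) c ∈ (⊥ : Submodule (ZMod p) _) := by
      refine supported_induction (subdiv b (m + 1)) ⊥ (fun v hv => ?_) hc
      rw [Submodule.mem_bot]
      refine subdiv_eq_zero φ β (fun n v => by rw [hb, tupleLabels]) v ?_ 1
      have h1 := hcard (Finset.univ.image v) (by
        intro a ha a' ha'
        obtain ⟨i, -, rfl⟩ := Finset.mem_image.1 ha
        obtain ⟨j, -, rfl⟩ := Finset.mem_image.1 ha'
        exact (hv.2 i j).trans_le hδδ)
      rw [← Finset.coe_image, Set.ncard_coe_finset, Finset.image_image] at h1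
      exact (h1.trans hm).trans_lt (Nat.lt_succ_self m)
    exact (Submodule.mem_bot _).1 this
  have h1 := hH (smith p g t (m + 1) c)
  rw [hc0, map_zero, sub_zero, smith_comm _ (subdiv_equivariant hbg (m + 1)), hT, map_zero,
    sub_zero, smith_comm _ (hHg (m + 1)), bd_smith] at h1
  exact h1.symm

/-- Local form of Smith's theorem: homological local connectedness over `ZMod p` passes to the
fixed points of an isometry of order `p`. -/
theorem HomologicallyLC.fixedPoints (hX : HasSmallLabels X) (hg : Isometry g) (hgp : g ^ p = 1)
    {x : X} (hx : g x = x) {R : ℝ} (hR0 : 0 < R) (hR : IsCompact (closedBall x R))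
    (hL : HomologicallyLC p x) :
    HomologicallyLC p (⟨x, hx⟩ : {y | g y = y}) := by
  obtain ⟨K, hK⟩ := smithVanishing_of_le (p := p) hX hg hgp hx hR0 hR
  have hV : ∀ n m, K ≤ m + n → ∀ t, SmithVanishing p g x t m := by
    intro n
    induction n with
    | zero => exact fun m hm t => hK m hm t
    | succ n ih => exact fun m hm t => (ih (m + 1) (by omega) _).pred hg hgp hx hL
  classical
  let π : X → {y | g y = y} := fun y => if hy : g y = y then ⟨y, hy⟩ else ⟨x, hx⟩
  have hπ : ∀ y (hy : g y = y), π y = ⟨y, hy⟩ := fun y hy => dif_pos hy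
  intro m r hr
  obtain ⟨s, hs, h1⟩ := (hV K (m + 1) (by omega) _).fixed (t := true) hg hgp hx hL r hr
  refine ⟨s, hs, fun ε hε => ?_⟩
  obtain ⟨δ, hδ, h1⟩ := h1 ε hε
  refine ⟨δ, hδ, fun z hz hz0 => ?_⟩
  obtain ⟨f, hf, hfF, hfz⟩ := h1 (map Subtype.val (m + 1) z)
    (map_mem_fineChains (f := Subtype.val) (fun y hy => hy) (fun _ _ _ _ h => h) hz)
    (supported_induction _ _ (fun v _ => by
      rw [map_single]
      exact single_mem_chainsIn (fun i => (v i).2) 1) ((mem_supported _ _).2 (Set.subset_univ _)))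
    (by rw [bd_map, hz0, map_zero])
  refine ⟨map π (m + 2) f, ?_, ?_⟩
  · have h2 : f ∈ fineChains p (ball x r ∩ {y | g y = y}) ε (m + 2) := by
      rw [mem_supported] at hf hfF ⊢
      exact fun v hv => ⟨fun i => ⟨(hf hv).1 i, hfF hv i⟩, (hf hv).2⟩
    refine map_mem_fineChains (fun y hy => ?_) (fun y hy y' hy' h => ?_) h2
    · rw [hπ y hy.2]
      exact hy.1
    · rw [hπ y hy.2, hπ y' hy'.2]
      exact h
  · rw [bd_map, hfz, map_map]
    have : π ∘ Subtype.val = id := funext fun y => hπ y y.2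
    rw [this]
    exact map_eq_self (S := Set.univ) (fun _ _ => rfl)
      ((mem_supported _ _).2 fun _ _ _ => trivial)

end Smith

end

section

open Finsupp Metric TupleChain

section GroupInduction

lemma HomologicallyLC.of_isometryEquiv {X Y : Type*} [PseudoMetricSpace X] [PseudoMetricSpace Y]
    {p : ℕ} (e : X ≃ᵢ Y) {x : X} (h : HomologicallyLC p x) : HomologicallyLC p (e x) := by
  intro m r hr
  obtain ⟨s, hs, h⟩ := h m r hr
  refine ⟨s, hs, fun ε hε => ?_⟩
  obtain ⟨δ, hδ, h⟩ := h ε hε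
  refine ⟨δ, hδ, fun z hz hz0 => ?_⟩
  obtain ⟨c, hc, hcz⟩ := h (map e.symm (m + 1) z)
    (map_mem_fineChains (fun y hy => by
      rw [mem_ball, ← e.dist_eq, e.apply_symm_apply]
      exact hy) (fun a _ b _ hab => by rwa [e.symm.dist_eq]) hz)
    (by rw [bd_map, hz0, map_zero])
  refine ⟨map e (m + 2) c, map_mem_fineChains (fun y hy => by
      rw [mem_ball, e.dist_eq]
      exact hy) (fun a _ b _ hab => by rwa [e.dist_eq]) hc, ?_⟩
  rw [bd_map, hcz, map_map]
  exact map_eq_self (S := Set.univ) (fun a _ => e.apply_symm_apply a)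
    ((mem_supported _ _).2 fun _ _ _ => trivial)

/-- In a group acting on a type, a point fixed by a subgroup of prime index and by an element
outside this subgroup is fixed by the whole group. -/
lemma MulAction.mem_fixedPoints_of_index_prime {G X : Type*} [Group G] [MulAction G X]
    {K : Subgroup G} (hK : K.index.Prime) {g : G} (hg : g ∉ K) {x : X}
    (hKx : ∀ k ∈ K, k • x = x) (hgx : g • x = x) : x ∈ MulAction.fixedPoints G X := by
  have hle : K ≤ MulAction.stabilizer G x := fun k hk => hKx k hk
  have hmul := Subgroup.relIndex_mul_index hle
  rcases (Nat.dvd_prime hK).1 (Dvd.intro_left _ hmul) with h | h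
  · rw [Subgroup.index_eq_one] at h
    exact fun a => MulAction.mem_stabilizer_iff.1 (h ▸ Subgroup.mem_top a)
  · rw [h] at hmul
    have h1 := Nat.eq_of_mul_eq_mul_right hK.pos (hmul.trans (one_mul _).symm)
    exact absurd (Subgroup.relIndex_eq_one.1 h1 hgx) hg

/-- Homological local connectedness over `ZMod p` passes to the fixed points of an isometric
action of a finite `p`-group. -/
theorem HomologicallyLC.fixedPoints_of_card {p : ℕ} [Fact p.Prime] {X : Type*} [MetricSpace X]
    [LocallyCompactSpace X] (hX : HasSmallLabels X) (n : ℕ) {G : Type*} [Group G] [Finite G]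
    [MulAction G X] (hG : Nat.card G = p ^ n) (hiso : ∀ g : G, Isometry (fun x : X => g • x))
    (hL : ∀ x : X, HomologicallyLC p x) (x : MulAction.fixedPoints G X) :
    HomologicallyLC p x := by
  have hp : p.Prime := Fact.out
  induction n generalizing G with
  | zero =>
    have : Subsingleton G := (Nat.card_eq_one_iff_unique.1 (by simpa using hG)).1
    let e : X ≃ᵢ MulAction.fixedPoints G X :=
      { toFun := fun y => ⟨y, fun a => by rw [Subsingleton.elim a 1, one_smul]⟩
        invFun := Subtype.val
        left_inv := fun _ => rfl
        right_inv := fun _ => rfl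
        isometry_toFun := fun _ _ => rfl }
    exact HomologicallyLC.of_isometryEquiv e (hL x)
  | succ n ih =>
    obtain ⟨K, hK⟩ := Sylow.exists_subgroup_card_pow_prime (G := G) p (n := n)
      (hG ▸ pow_dvd_pow p n.le_succ)
    have hKp : K.index = p := by
      have h := K.card_mul_index
      rw [hK, hG, pow_succ] at h
      exact Nat.eq_of_mul_eq_mul_left (pow_pos hp.pos n) h
    have hKn : K.Normal := Subgroup.normal_of_index_eq_minFac_card
      (by rw [hKp, hG, hp.pow_minFac n.succ_ne_zero])
    obtain ⟨g, hg⟩ : ∃ g, g ∉ K := by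
      by_contra! h
      rw [(Subgroup.eq_top_iff' K).2 h, Subgroup.index_top] at hKp
      exact hp.one_lt.ne hKp
    have hKL := ih (G := K) hK fun k => hiso k
    have hmem : ∀ a : G, ∀ y ∈ MulAction.fixedPoints K X, a • y ∈ MulAction.fixedPoints K X := by
      intro a y hy k
      have h1 : a⁻¹ * k * a ∈ K := by simpa using hKn.conj_mem k k.2 a⁻¹
      have h2 : (a⁻¹ * k * a) • y = y := hy ⟨_, h1⟩
      rw [mul_assoc, mul_smul, inv_smul_eq_iff, mul_smul] at h2
      exact h2
    let σ : Equiv.Perm (MulAction.fixedPoints K X) :=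
      { toFun := fun y => ⟨g • (y : X), hmem g y y.2⟩
        invFun := fun y => ⟨g⁻¹ • (y : X), hmem g⁻¹ y y.2⟩
        left_inv := fun y => Subtype.ext (inv_smul_smul g (y : X))
        right_inv := fun y => Subtype.ext (smul_inv_smul g (y : X)) }
    have hσ : ∀ y, (σ y : X) = g • (y : X) := fun _ => rfl
    have hσn : ∀ n : ℕ, ∀ y, ((σ ^ n) y : X) = g ^ n • (y : X) := by
      intro n
      induction n with
      | zero => simp
      | succ n ih =>
        intro y
        rw [pow_succ', Equiv.Perm.mul_apply, hσ, ih, pow_succ', mul_smul]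
    have hσp : σ ^ p = 1 := by
      ext y
      rw [hσn]
      exact y.2 ⟨g ^ p, hKp ▸ K.pow_index_mem g⟩
    have hσi : Isometry σ := fun y z => hiso g y z
    have hclosed : IsClosed (MulAction.fixedPoints K X) := by
      have : MulAction.fixedPoints K X = ⋂ k : K, {y | k • y = y} := by
        ext y
        simp [MulAction.mem_fixedPoints]
      rw [this]
      exact isClosed_iInter fun k => isClosed_eq (hiso k).continuous continuous_id
    have : LocallyCompactSpace (MulAction.fixedPoints K X) := hclosed.locallyCompactSpace
    have hfix : ∀ y : MulAction.fixedPoints K X, σ y = y → (y : X) ∈ MulAction.fixedPoints G X :=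
      fun y hy => MulAction.mem_fixedPoints_of_index_prime (hKp ▸ hp) hg
        (fun k hk => y.2 ⟨k, hk⟩) ((hσ y).symm.trans (congrArg Subtype.val hy))
    let x' : MulAction.fixedPoints K X := ⟨x, fun k => x.2 k⟩
    have hx' : σ x' = x' := Subtype.ext (x.2 g)
    obtain ⟨R, hR0, hR⟩ := exists_isCompact_closedBall x'
    let e : {y | σ y = y} ≃ᵢ MulAction.fixedPoints G X :=
      { toFun := fun y => ⟨y, hfix y y.2⟩
        invFun := fun y => ⟨⟨y, fun k => y.2 k⟩, Subtype.ext (y.2 g)⟩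
        left_inv := fun _ => rfl
        right_inv := fun _ => rfl
        isometry_toFun := fun _ _ => rfl }
    exact HomologicallyLC.of_isometryEquiv e
      (HomologicallyLC.fixedPoints (hX.subtype _) hσi hσp hx' hR0 hR (hKL x'))

end GroupInduction

end

section

open Finsupp Metric TupleChain

section Chains

variable {X : Type*} [PseudoMetricSpace X]

/-- `a` and `b` are joined by a chain of points of `S` with steps shorter than `ε`. -/
def ChainJoined (S : Set X) (ε : ℝ) : X → X → Prop :=
  Relation.ReflTransGen fun a b => a ∈ S ∧ b ∈ S ∧ dist a b < ε

lemma HomologicallyLC.chainJoined {p : ℕ} [Fact p.Prime] {x : X} (h : HomologicallyLC p x)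
    {r : ℝ} (hr : 0 < r) : ∃ s > 0, ∀ ε > 0, ∀ a ∈ ball x s, ∀ b ∈ ball x s,
      ChainJoined (ball x r) ε a b := by
  classical
  obtain ⟨s, hs, h⟩ := h 0 r hr
  refine ⟨s, hs, fun ε hε a ha b hb => ?_⟩
  obtain ⟨δ, hδ, h⟩ := h ε hε
  have hmem : ∀ y ∈ ball x s, (single (fun _ => y) 1 : TupleChain (ZMod p) X 1) ∈
      fineChains p (ball x s) δ 1 := fun y hy =>
    single_mem_supported _ _ ⟨fun _ => hy, fun _ _ => by rwa [dist_self]⟩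
  have hbd0 : ∀ v : Fin 1 → X, bd 0 (single v (1 : ZMod p)) = single ![] 1 := fun v => by
    simp [bd]
  obtain ⟨c, hc, hcz⟩ := h _ (sub_mem (hmem a ha) (hmem b hb))
    (by rw [map_sub, hbd0, hbd0, sub_self])
  let χ : TupleChain (ZMod p) X 1 →ₗ[ZMod p] ZMod p :=
    linearCombination _ fun v => if ChainJoined (ball x r) ε a (v 0) then 1 else 0
  have hχ : χ (bd 1 c) = 0 := by
    refine (Submodule.mem_bot (ZMod p)).1 (supported_induction (χ ∘ₗ bd 1) ⊥ (fun e he => ?_) hc)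
    have hiff : ChainJoined (ball x r) ε a (e 0) ↔ ChainJoined (ball x r) ε a (e 1) :=
      ⟨fun h' => h'.tail ⟨he.1 0, he.1 1, he.2 0 1⟩, fun h' => h'.tail ⟨he.1 1, he.1 0, he.2 1 0⟩⟩
    have : bd 1 (single e (1 : ZMod p)) = single (fun _ => e 1) 1 - single (fun _ => e 0) 1 := by
      have h0 : Fin.tail e = fun _ => e 1 := funext fun i => by fin_cases i; rfl
      have h1 : (Fin.cons (e 0) ![] : Fin 1 → X) = fun _ => e 0 :=
        funext fun i => by fin_cases i; rfl
      rw [bd, linearCombination_single, one_smul, hbd0, cone_single, h0, h1]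
    rw [Submodule.mem_bot, LinearMap.comp_apply, this, map_sub]
    simp [χ, hiff]
  have h1 : χ (single (fun _ => a) 1) = 1 := by
    simp [χ, ChainJoined, Relation.ReflTransGen.refl]
  rw [hcz, map_sub, h1] at hχ
  by_contra h'
  simp [χ, h'] at hχ

end Chains

end

section

open Metric

section Paths

variable {X : Type*} [PseudoMetricSpace X]

lemma ChainJoined.exists_seq {S : Set X} {ε : ℝ} (hε : 0 < ε) {a b : X} (ha : a ∈ S)
    (h : ChainJoined S ε a b) : ∃ (d : ℕ → X) (n : ℕ), d 0 = a ∧ (∀ j ≥ n, d j = b) ∧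
      ∀ j, d j ∈ S ∧ dist (d j) (d (j + 1)) < ε := by
  induction h with
  | refl => exact ⟨fun _ => a, 0, rfl, fun _ _ => rfl, fun _ => ⟨ha, by rwa [dist_self]⟩⟩
  | @tail b c _ hbc ih =>
    obtain ⟨d, n, h0, hn, hd⟩ := ih
    refine ⟨fun j => if j ≤ n then d j else c, n + 1, by simp [h0],
      fun j hj => if_neg (by omega), fun j => ?_⟩
    rcases lt_trichotomy j n with hj | rfl | hj
    · simp only [hj.le, Nat.succ_le_of_lt hj, if_true]
      exact hd j
    · simp only [le_refl, if_true, Nat.not_succ_le_self, if_false]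
      exact ⟨(hd _).1, hn j le_rfl ▸ hbc.2.2⟩
    · simp only [not_le.2 hj, not_le.2 (hj.trans j.lt_succ_self), if_false]
      exact ⟨hbc.2.1, by rwa [dist_self]⟩

/-- A possibly discontinuous path from `a` to `b`, with jumps shorter than `s`. -/
def IsRoughPath (a b : X) (s : ℝ) (f : ℝ → X) : Prop :=
  (∀ t ≤ 0, f t = a) ∧ (∀ t ≥ 1, f t = b) ∧
    ∃ η > 0, ∀ t t', |t - t'| ≤ η → dist (f t) (f t') < s

lemma IsRoughPath.refine {a b : X} {s s' r : ℝ} {f : ℝ → X} (hf : IsRoughPath a b s f)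
    (hs' : 0 < s') (hr : 0 < r)
    (h : ∀ t c, dist (f t) c < s → ChainJoined (ball (f t) r) s' (f t) c) :
    ∃ f', IsRoughPath a b s' f' ∧ ∀ t, dist (f t) (f' t) ≤ r + s := by
  obtain ⟨h0, h1, η, hη, hfη⟩ := hf
  obtain ⟨N, hN⟩ := exists_nat_one_div_lt hη
  set M : ℕ := N + 1 with hM
  have hM0 : (0 : ℝ) < M := by positivity
  have hMη : 1 / (M : ℝ) < η := by rw [hM]; exact_mod_cast hN
  have hstep : ∀ i : ℕ, dist (f (i / M)) (f ((i + 1 : ℕ) / M)) < s := fun i => by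
    refine hfη _ _ ?_
    rw [← sub_div, abs_div, abs_of_pos hM0]
    push_cast
    rw [sub_add_cancel_left, abs_neg, abs_one]
    exact hMη.le
  have hd : ∃ n > 0, ∀ i : ℕ, ∃ d : ℕ → X, d 0 = f (i / M) ∧
      (∀ j ≥ n, d j = f ((i + 1 : ℕ) / M)) ∧
      (M ≤ i → ∀ j, d j = b) ∧
      ∀ j, d j ∈ ball (f (i / M)) r ∧ dist (d j) (d (j + 1)) < s' := by
    have := fun i : ℕ => (h _ _ (hstep i)).exists_seq hs' (mem_ball_self hr)
    choose d n hd0 hdn hd using this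
    refine ⟨(Finset.range M).sup n + 1, Nat.succ_pos _, fun i => ?_⟩
    by_cases hi : i < M
    · exact ⟨d i, hd0 i, fun j hj => hdn i j
        ((Finset.le_sup (Finset.mem_range.2 hi)).trans ((Nat.le_succ _).trans hj)),
        fun h' => absurd hi (not_lt.2 h'), hd i⟩
    · have hi' : M ≤ i := not_lt.1 hi
      have hge : ∀ k : ℕ, M ≤ k → f (k / M) = b := fun k hk =>
        h1 _ ((one_le_div hM0).2 (by exact_mod_cast hk))
      refine ⟨fun _ => f (i / M), rfl, fun j _ => ?_, fun _ _ => hge i hi', fun _ =>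
        ⟨mem_ball_self hr, by rwa [dist_self]⟩⟩
      rw [hge i hi', hge (i + 1) (by omega)]
  obtain ⟨n, hn, hd⟩ := hd
  choose d hd0 hdn hdb hd using hd
  have hn0 : (0 : ℝ) < n := by exact_mod_cast hn
  let c : ℕ → X := fun m => d (m / n) (m % n)
  have hc : ∀ m, dist (c m) (c (m + 1)) < s' := by
    intro m
    have key : c (m + 1) = d (m / n) (m % n + 1) := by
      rcases (Nat.succ_le_of_lt (Nat.mod_lt m hn)).lt_or_eq with hm | hm
      · obtain ⟨h1, h2⟩ := (Nat.div_mod_unique (a := m + 1) (c := m % n + 1) (d := m / n) hn).2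
          ⟨by have := Nat.mod_add_div m n; omega, hm⟩
        simp only [c, h1, h2]
      · obtain ⟨h1, h2⟩ := (Nat.div_mod_unique (a := m + 1) (c := 0) (d := m / n + 1) hn).2
          ⟨by have := Nat.mod_add_div m n; rw [mul_add]; omega, hn⟩
        simp only [c, h1, h2]
        rw [hd0, hdn _ _ hm.ge]
    rw [key]
    exact (hd _ _).2
  refine ⟨fun t => c ⌊t * (M * n)⌋₊, ⟨fun t ht => ?_, fun t ht => ?_, 1 / (M * n), by positivity,
    fun t t' htt => ?_⟩, fun t => ?_⟩
  · have h2 : t * (M * n) ≤ 0 := mul_nonpos_of_nonpos_of_nonneg ht (by positivity)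
    simp only [Nat.floor_of_nonpos h2, c, Nat.zero_div, Nat.zero_mod, hd0]
    exact h0 _ (by simp)
  · refine hdb _ ?_ _
    rw [Nat.le_div_iff_mul_le hn]
    refine Nat.le_floor ?_
    push_cast
    exact le_mul_of_one_le_left (by positivity) ht
  · have aux : ∀ u u' : ℝ, u ≤ u' → u' ≤ u + 1 → dist (c ⌊u⌋₊) (c ⌊u'⌋₊) < s' := by
      intro u u' h1 h2
      have h3 := Nat.floor_le_floor h1
      have h4 : ⌊u'⌋₊ < ⌊u⌋₊ + 2 := by
        rw [Nat.floor_lt' (by omega)]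
        have := Nat.lt_floor_add_one u
        push_cast
        linarith
      obtain h5 | h5 : ⌊u'⌋₊ = ⌊u⌋₊ ∨ ⌊u'⌋₊ = ⌊u⌋₊ + 1 := by omega
      · rwa [h5, dist_self]
      · rw [h5]
        exact hc _
    have hMn : (0 : ℝ) < M * n := by positivity
    rw [le_div_iff₀ hMn] at htt
    have h2 := abs_le.1 ((abs_mul _ _).trans_le ((abs_of_pos hMn).symm ▸ htt))
    rw [sub_mul] at h2
    rcases le_total (t * (M * n)) (t' * (M * n)) with h3 | h3
    · exact aux _ _ h3 (by linarith)
    · rw [dist_comm]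
      exact aux _ _ h3 (by linarith)
  · set m := ⌊t * (M * n)⌋₊ with hm
    have hmn : m / n = ⌊t * M⌋₊ := by
      rw [hm, ← Nat.floor_div_natCast, ← mul_assoc, mul_div_cancel_right₀ _ hn0.ne']
    have h2 : dist (f t) (f ((m / n : ℕ) / M)) < s := by
      rcases le_total t 0 with ht | ht
      · have : ⌊t * M⌋₊ = 0 := Nat.floor_of_nonpos (mul_nonpos_of_nonpos_of_nonneg ht hM0.le)
        rw [hmn, this, h0 t ht, h0 _ (by simp), dist_self]
        exact dist_nonneg.trans_lt (hstep 0)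
      · refine hfη _ _ ?_
        have h3 := Nat.floor_le (mul_nonneg ht hM0.le)
        have h4 := Nat.lt_floor_add_one (t * M)
        rw [← hmn] at h3 h4
        have h5 : t - (m / n : ℕ) / M = (t * M - (m / n : ℕ)) / M := by field_simp
        rw [h5, abs_div, abs_of_pos hM0, abs_of_nonneg (by linarith)]
        refine le_trans ?_ hMη.le
        gcongr
        linarith
    have h3 := (hd (m / n) (m % n)).1
    rw [mem_ball, dist_comm] at h3
    linarith [dist_triangle (f t) (f ((m / n : ℕ) / M)) (c m)]

lemma exists_uniform_chainJoined
    (h : ∀ x : X, ∀ r > 0, ∃ s > 0, ∀ ε > 0, ∀ a ∈ ball x s, ∀ b ∈ ball x s,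
      ChainJoined (ball x r) ε a b) {K : Set X} (hK : IsCompact K) {r : ℝ} (hr : 0 < r) :
    ∃ s > 0, s ≤ r ∧ ∀ a ∈ K, ∀ b, dist a b < s → ∀ ε > 0, ChainJoined (ball a r) ε a b := by
  choose s hs h using fun x => h x (r / 2) (half_pos hr)
  obtain ⟨δ, hδ, hδK⟩ := lebesgue_number_lemma_of_metric hK
    (c := fun x => ball x (min (s x) (r / 2))) (fun _ => isOpen_ball)
    (fun a _ => Set.mem_iUnion.2 ⟨a, mem_ball_self (lt_min (hs a) (half_pos hr))⟩)
  refine ⟨min δ r, lt_min hδ hr, min_le_right _ _, fun a ha b hab ε hε => ?_⟩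
  obtain ⟨x, hx⟩ := hδK a ha
  have hax := hx (mem_ball_self hδ)
  have hbx := hx (mem_ball'.2 (hab.trans_le (min_le_left _ _)))
  have hball : ball x (r / 2) ⊆ ball a r := by
    refine ball_subset_ball' ?_
    have := (mem_ball'.1 hax).trans_le (min_le_right _ _)
    linarith
  have hab' := h x ε hε a (ball_subset_ball (min_le_left _ _) hax) b
    (ball_subset_ball (min_le_left _ _) hbx)
  exact Relation.ReflTransGen.mono (fun _ _ huv => ⟨hball huv.1, hball huv.2.1, huv.2.2⟩) _ _ hab'

end Paths

section Limit

variable {X : Type*} [MetricSpace X]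

lemma joinedIn_of_isRoughPath {x b : X} {R : ℝ} (hR : IsCompact (closedBall x R))
    {f : ℕ → ℝ → X} {s : ℕ → ℝ} (hs : ∀ k, s k ≤ R / 2 ^ k)
    (hf : ∀ k, IsRoughPath x b (s k) (f k)) (hfR : ∀ k t, f k t ∈ closedBall x R)
    (hff : ∀ k t, dist (f k t) (f (k + 1) t) ≤ R / 2 / 2 ^ k) : JoinedIn (closedBall x R) x b := by
  have hlim : ∀ t, ∃ y ∈ closedBall x R, Filter.Tendsto (fun k => f k t) Filter.atTop (nhds y) :=
    fun t => cauchySeq_tendsto_of_isComplete hR.isComplete (fun k => hfR k t)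
      (cauchySeq_of_le_geometric_two fun k => hff k t)
  choose φ hφR hφ using hlim
  have hdist : ∀ k t, dist (f k t) (φ t) ≤ R / 2 ^ k := fun k t =>
    dist_le_of_le_geometric_two_of_tendsto (fun k => hff k t) (hφ t) k
  have hcont : Continuous φ := by
    refine Metric.continuous_iff.2 fun t ε hε => ?_
    obtain ⟨k, hk⟩ := pow_unbounded_of_one_lt (3 * R / ε) one_lt_two
    rw [div_lt_iff₀ hε, mul_comm _ ε, ← div_lt_iff₀ (by positivity), mul_div_assoc] at hk
    obtain ⟨-, -, η, hη, hfη⟩ := hf k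
    refine ⟨η, hη, fun t' ht' => ?_⟩
    have h1 := hfη t' t ht'.le
    have h2 := hdist k t
    have h3 := hdist k t'
    have h4 := dist_triangle4_left (f k t') (f k t) (φ t') (φ t)
    have h5 := hs k
    linarith
  refine JoinedIn.ofLine hcont.continuousOn ?_ ?_ ?_
  · refine tendsto_nhds_unique (hφ 0) ?_
    simp only [fun k => (hf k).1 0 le_rfl, tendsto_const_nhds]
  · refine tendsto_nhds_unique (hφ 1) ?_
    simp only [fun k => (hf k).2.1 1 le_rfl, tendsto_const_nhds]
  · rintro _ ⟨t, -, rfl⟩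
    exact hφR t

/-- A locally compact metric space is locally path-connected as soon as nearby points are joined
by chains with arbitrarily small steps which stay nearby. -/
theorem locallyPathConnectedSpace_of_chainJoined [LocallyCompactSpace X]
    (h : ∀ x : X, ∀ r > 0, ∃ s > 0, ∀ ε > 0, ∀ a ∈ ball x s, ∀ b ∈ ball x s,
      ChainJoined (ball x r) ε a b) : LocallyPathConnectedSpace X := by
  rw [locallyPathConnectedSpace_iff_pathComponentIn_mem_nhds]
  intro x u hu hxu
  obtain ⟨R₁, hR₁, hRu⟩ := isOpen_iff.1 hu x hxu
  obtain ⟨R₂, hR₂, hR⟩ := exists_isCompact_closedBall x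
  obtain ⟨R, hR0, hRR₁, hRR₂⟩ : ∃ R > 0, R < R₁ ∧ R ≤ R₂ :=
    ⟨min (R₁ / 2) R₂, lt_min (half_pos hR₁) hR₂, (min_le_left _ _).trans_lt (half_lt_self hR₁),
      min_le_right _ _⟩
  replace hR : IsCompact (closedBall x R) :=
    hR.of_isClosed_subset isClosed_closedBall (closedBall_subset_closedBall hRR₂)
  replace hRu : closedBall x R ⊆ u := (closedBall_subset_ball hRR₁).trans hRu
  have hr : ∀ k : ℕ, 0 < R / 8 / 2 ^ k := fun k => by positivity
  choose s hs hsr hsU using fun k => exists_uniform_chainJoined h hR (hr k)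
  refine mem_nhds_iff.2 ⟨s 0, hs 0, fun b hb => ?_⟩
  suffices JoinedIn (closedBall x R) x b from this.mono hRu
  let P : ℕ → (ℝ → X) → Prop := fun k f => IsRoughPath x b (s k) f ∧
    ∀ t, dist (f t) x ≤ R - R / 2 / 2 ^ k
  have h0 : ∃ f, P 0 f := by
    have hxb : dist b x < s 0 := hb
    have hs0 := hs 0
    have hsR := hsr 0
    rw [pow_zero, div_one] at hsR
    refine ⟨fun t => if t ≤ 0 then x else b, ⟨fun t ht => if_pos ht,
      fun t ht => if_neg (by linarith), 1, one_pos, fun t t' _ => ?_⟩, fun t => ?_⟩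
    · dsimp only
      split_ifs
      · rwa [dist_self]
      · rwa [dist_comm]
      · exact hxb
      · rwa [dist_self]
    · dsimp only
      rw [pow_zero, div_one]
      split_ifs
      · rw [dist_self]
        linarith
      · linarith
  have hstep : ∀ k (f : {f // P k f}), ∃ f' : {f // P (k + 1) f},
      ∀ t, dist (f.1 t) (f'.1 t) ≤ R / 4 / 2 ^ k := by
    rintro k ⟨f, hf, hfx⟩
    obtain ⟨f', hf', hff'⟩ := hf.refine (hs (k + 1)) (hr k) fun t c hc =>
      hsU k (f t) ((hfx t).trans (sub_le_self _ (by positivity))) c hc _ (hs (k + 1))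
    have hd : ∀ t, dist (f t) (f' t) ≤ R / 4 / 2 ^ k := fun t =>
      (hff' t).trans ((add_le_add_right (hsr k) _).trans_eq (by ring))
    refine ⟨⟨f', hf', fun t => ?_⟩, hd⟩
    have h1 := dist_triangle_left (f' t) x (f t)
    have h2 : R / 2 / 2 ^ (k + 1) = R / 4 / 2 ^ k := by rw [pow_succ]; field_simp; norm_num
    have h3 : R / 2 / 2 ^ k = R / 4 / 2 ^ k + R / 4 / 2 ^ k := by ring
    rw [h2]
    linarith [hfx t, hd t]
  choose next hnext using hstep
  obtain ⟨f₀, hf₀⟩ := h0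
  let f : ∀ k, {f // P k f} := fun k => Nat.rec ⟨f₀, hf₀⟩ next k
  refine joinedIn_of_isRoughPath hR (f := fun k => (f k).1) (s := s)
    (fun k => (hsr k).trans ?_) (fun k => (f k).2.1)
    (fun k t => ((f k).2.2 t).trans (sub_le_self _ (by positivity)))
    (fun k t => (hnext k (f k) t).trans ?_)
  · gcongr
    linarith
  · gcongr
    linarith

end Limit

end

section

open Finsupp Metric TupleChain

section SmallLabels

lemma hasSmallLabels_real : HasSmallLabels ℝ := by
  refine ⟨3, fun ε hε => ⟨ε, hε, ℤ, fun t => ⌊t / ε⌋, fun a b hab => ?_, fun s hs => ?_⟩⟩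
  · have := Int.abs_sub_lt_one_of_floor_eq_floor hab
    rwa [← sub_div, abs_div, abs_of_pos hε, div_lt_one hε] at this
  · obtain rfl | ⟨a, ha⟩ := s.eq_empty_or_nonempty
    · simp
    have : (fun t : ℝ => ⌊t / ε⌋) '' s ⊆ Finset.Icc (⌊a / ε⌋ - 1) (⌊a / ε⌋ + 1) := by
      rintro _ ⟨b, hb, rfl⟩
      have h1 := hs a ha b hb
      rw [Real.dist_eq, abs_lt] at h1
      have h2 : b / ε ≤ a / ε + 1 := by
        rw [div_add_one hε.ne']
        gcongr
        linarith
      have h3 : a / ε ≤ b / ε + 1 := by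
        rw [div_add_one hε.ne']
        gcongr
        linarith
      have h4 := Int.floor_le_floor h2
      have h5 := Int.floor_le_floor h3
      rw [Int.floor_add_one] at h4 h5
      rw [Finset.coe_Icc, Set.mem_Icc]
      constructor <;> linarith
    refine (Set.ncard_le_ncard this (Finset.finite_toSet _)).trans ?_
    rw [Set.ncard_coe_finset, Int.card_Icc]
    omega

lemma HasSmallLabels.pi {ι : Type} [Fintype ι] {X : Type*} [PseudoMetricSpace X]
    (hX : HasSmallLabels X) : HasSmallLabels (ι → X) := by
  obtain ⟨K, hK⟩ := hX
  refine ⟨K ^ Fintype.card ι, fun ε hε => ?_⟩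
  obtain ⟨δ, hδ, I, φ, h1, h2⟩ := hK ε hε
  classical
  refine ⟨δ, hδ, ι → I, fun a i => φ (a i),
    fun a b hab => (dist_pi_lt_iff hε).2 fun i => h1 _ _ (congrFun hab i), fun s hs => ?_⟩
  have hsub : s.image (fun a i => φ (a i)) ⊆ Fintype.piFinset fun i : ι =>
      (s.image fun a => a i).image φ := by
    intro u hu
    obtain ⟨a, ha, rfl⟩ := Finset.mem_image.1 hu
    exact Fintype.mem_piFinset.2 fun i => Finset.mem_image_of_mem _
      (Finset.mem_image_of_mem (fun a : ι → X => a i) ha)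
  rw [← Finset.coe_image, Set.ncard_coe_finset]
  refine (Finset.card_le_card hsub).trans ?_
  rw [Fintype.card_piFinset]
  refine Finset.prod_le_pow_card _ _ K fun i _ => ?_
  rw [← Set.ncard_coe_finset, Finset.coe_image]
  refine h2 _ fun a ha b hb => ?_
  obtain ⟨a', ha', rfl⟩ := Finset.mem_image.1 ha
  obtain ⟨b', hb', rfl⟩ := Finset.mem_image.1 hb
  exact (dist_le_pi_dist a' b' i).trans_lt (hs a' ha' b' hb')

lemma HasSmallLabels.of_isometry {X Y : Type*} [PseudoMetricSpace X] [PseudoMetricSpace Y]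
    {f : X → Y} (hf : Isometry f) (hY : HasSmallLabels Y) : HasSmallLabels X := by
  obtain ⟨K, hK⟩ := hY
  refine ⟨K, fun ε hε => ?_⟩
  obtain ⟨δ, hδ, I, φ, h1, h2⟩ := hK ε hε
  classical
  refine ⟨δ, hδ, I, φ ∘ f, fun a b hab => hf.dist_eq a b ▸ h1 _ _ hab, fun s hs => ?_⟩
  rw [Set.image_comp, ← Finset.coe_image]
  refine h2 _ fun a ha b hb => ?_
  obtain ⟨a', ha', rfl⟩ := Finset.mem_image.1 ha
  obtain ⟨b', hb', rfl⟩ := Finset.mem_image.1 hb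
  rw [hf.dist_eq]
  exact hs a' ha' b' hb'

end SmallLabels

section Contraction

variable {p : ℕ}

lemma exists_bd_eq_map_sub_map {X Y : Type*} [PseudoMetricSpace X] [PseudoMetricSpace Y]
    {S : Set X} {S' : Set Y} {δ ε : ℝ} {f g : X → Y} (hf : Set.MapsTo f S S')
    (hg : Set.MapsTo g S S')
    (hff : ∀ a ∈ S, ∀ b ∈ S, dist a b < δ → dist (f a) (f b) < ε)
    (hfg : ∀ a ∈ S, ∀ b ∈ S, dist a b < δ → dist (f a) (g b) < ε)
    (hgg : ∀ a ∈ S, ∀ b ∈ S, dist a b < δ → dist (g a) (g b) < ε) {m : ℕ}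
    {z : TupleChain (ZMod p) X (m + 1)} (hz : z ∈ fineChains p S δ (m + 1)) (hz0 : bd m z = 0) :
    ∃ c ∈ fineChains p S' ε (m + 2), bd (m + 1) c = map f (m + 1) z - map g (m + 1) z := by
  refine ⟨homotopy (fun _ v => f (v 0)) (map f) (map g) (m + 1) z,
    supported_induction _ _ (fun v hv => ?_) hz, ?_⟩
  · have hY : homotopy (fun _ v => f (v 0)) (map f) (map g) (m + 1) (single v (1 : ZMod p)) ∈
        chainsIn (ZMod p) (f '' Set.range v ∪ g '' Set.range v) (m + 2) := by
      refine homotopy_mem (S := f '' Set.range v ∪ g '' Set.range v) (Set.range v)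
        (fun n u hu => ?_) (fun n u hu => ?_) (fun n u hu => Or.inl ⟨_, hu 0, rfl⟩)
        (fun i => ⟨i, rfl⟩)
      · rw [map_single]
        refine single_mem_chainsIn (R := ZMod p) (fun i => ?_) 1
        exact Or.inl ⟨_, hu i, rfl⟩
      · rw [map_single]
        refine single_mem_chainsIn (R := ZMod p) (fun i => ?_) 1
        exact Or.inr ⟨_, hu i, rfl⟩
    rw [mem_supported] at hY ⊢
    refine fun u hu => ⟨fun i => ?_, fun i j => ?_⟩
    · obtain ⟨_, ⟨k, rfl⟩, hk⟩ | ⟨_, ⟨k, rfl⟩, hk⟩ := hY hu i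
      · exact hk ▸ hf (hv.1 k)
      · exact hk ▸ hg (hv.1 k)
    · obtain ⟨_, ⟨k, rfl⟩, hk⟩ | ⟨_, ⟨k, rfl⟩, hk⟩ := hY hu i <;>
        obtain ⟨_, ⟨l, rfl⟩, hl⟩ | ⟨_, ⟨l, rfl⟩, hl⟩ := hY hu j <;> rw [← hk, ← hl]
      · exact hff _ (hv.1 k) _ (hv.1 l) (hv.2 k l)
      · exact hfg _ (hv.1 k) _ (hv.1 l) (hv.2 k l)
      · rw [dist_comm]
        exact hfg _ (hv.1 l) _ (hv.1 k) (hv.2 l k)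
      · exact hgg _ (hv.1 k) _ (hv.1 l) (hv.2 k l)
  · have h0 : map f 0 = (map g 0 : TupleChain (ZMod p) X 0 →ₗ[ZMod p] _) := by
      refine ext_single fun v => ?_
      rw [map_single, map_single]
      congr 1
      exact Subsingleton.elim _ _
    rw [bd_homotopy (bd_map f) (bd_map g) h0, hz0, map_zero, sub_zero]

lemma exists_bd_eq_of_mem_ball {V : Type*} [NormedAddCommGroup V] [NormedSpace ℝ V] (x : V)
    {ρ ε : ℝ} (hρ : 0 < ρ) (hε : 0 < ε) :
    ∃ δ > 0, ∀ (m : ℕ), ∀ z ∈ fineChains p (ball x ρ) δ (m + 1),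
      bd m z = 0 → ∃ c ∈ fineChains p (ball x ρ) ε (m + 2), bd (m + 1) c = z := by
  refine ⟨ε / 2, half_pos hε, fun m z hz hz0 => ?_⟩
  obtain ⟨N, hN⟩ := exists_nat_gt (ρ / (ε / 2))
  have hN0 : (0 : ℝ) < N := (by positivity : 0 < ρ / (ε / 2)).trans hN
  let F : ℕ → V → V := fun j => AffineMap.homothety x (1 - j / N : ℝ)
  have hF : ∀ j ≤ N, ∀ a b, dist (F j a) (F j b) ≤ dist a b := by
    intro j hj a b
    have h1 : (j : ℝ) / N ≤ 1 := (div_le_one hN0).2 (by exact_mod_cast hj)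
    have h2 : 0 ≤ (j : ℝ) / N := by positivity
    have h3 : F j a - F j b = (1 - j / N : ℝ) • (a - b) := by
      simp only [F, AffineMap.homothety_apply, vsub_eq_sub, vadd_eq_add]
      module
    rw [dist_eq_norm, dist_eq_norm, h3, norm_smul, Real.norm_eq_abs, abs_of_nonneg (by linarith)]
    exact mul_le_of_le_one_left (norm_nonneg _) (by linarith)
  have hFx : ∀ j, F j x = x := fun j => AffineMap.homothety_apply_same _ _
  have hFb : ∀ j ≤ N, Set.MapsTo (F j) (ball x ρ) (ball x ρ) := fun j hj a ha => by
    have := hF j hj a x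
    rw [hFx] at this
    exact this.trans_lt ha
  have hFF : ∀ j, ∀ a ∈ ball x ρ, dist (F j a) (F (j + 1) a) < ε / 2 := by
    intro j a ha
    have h1 : F j a - F (j + 1) a = (1 / N : ℝ) • (a - x) := by
      simp only [F, AffineMap.homothety_apply, vsub_eq_sub, vadd_eq_add]
      push_cast
      module
    rw [mem_ball, dist_eq_norm] at ha
    rw [div_lt_iff₀ (half_pos hε)] at hN
    rw [dist_eq_norm, h1, norm_smul, Real.norm_eq_abs, abs_of_pos (by positivity),
      one_div_mul_eq_div, div_lt_iff₀ hN0]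
    linarith
  have hind : ∀ j ≤ N, ∃ c ∈ fineChains p (ball x ρ) ε (m + 2),
      bd (m + 1) c = z - map (F j) (m + 1) z := by
    intro j
    induction j with
    | zero =>
      refine fun _ => ⟨0, zero_mem _, ?_⟩
      have : F 0 = id := by
        ext
        simp [F]
      rw [map_zero, this, map_eq_self (f := id) (S := Set.univ) (fun _ _ => rfl)
        ((mem_supported _ _).2 fun _ _ _ => trivial), sub_self]
    | succ j ih =>
      intro hj
      obtain ⟨c, hc, hcz⟩ := ih (by omega)
      obtain ⟨c', hc', hcz'⟩ := exists_bd_eq_map_sub_map (ε := ε) (hFb j (by omega)) (hFb _ hj)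
        (fun a _ b _ hab => ((hF j (by omega) a b).trans_lt hab).trans (by linarith))
        (fun a _ b hb hab => by
          have h1 := hF j (by omega) a b
          have h2 := hFF j b hb
          linarith [dist_triangle (F j a) (F j b) (F (j + 1) b)])
        (fun a _ b _ hab => ((hF _ hj a b).trans_lt hab).trans (by linarith)) hz hz0
      refine ⟨c + c', add_mem hc hc', ?_⟩
      rw [map_add, hcz, hcz']
      abel
  obtain ⟨c, hc, hcz⟩ := hind N le_rfl
  have hFN : ∀ a, F N a = x := fun a => by
    simp [F, div_self hN0.ne']
  refine ⟨c + cone x (map (F N) (m + 1) z), add_mem hc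
    (supported_induction (cone x ∘ₗ map (F N) (m + 1)) _ (fun v _ => ?_) hz), ?_⟩
  · rw [LinearMap.comp_apply, map_single, cone_single]
    have : (Fin.cons x (F N ∘ v) : Fin (m + 2) → V) = fun _ => x := by
      ext i
      refine Fin.cases rfl (fun i => ?_) i
      simp [hFN]
    rw [this]
    exact single_mem_supported _ _
      ⟨fun _ => mem_ball_self hρ, fun _ _ => by rwa [dist_self]⟩
  · rw [map_add, hcz, bd_cone, bd_map, hz0, map_zero, map_zero]
    abel

/-- Spaces with a uniformly continuous open embedding into a proper normed space are
homologically locally connected. -/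
lemma homologicallyLC_of_isOpenEmbedding {X V : Type*} [PseudoMetricSpace X]
    [NormedAddCommGroup V] [NormedSpace ℝ V] [ProperSpace V] {f : X → V}
    (hf : Topology.IsOpenEmbedding f) (hfd : ∀ a b, dist (f a) (f b) ≤ dist a b) (x : X) :
    HomologicallyLC p x := by
  have : Nonempty X := ⟨x⟩
  intro m r hr
  obtain ⟨ρ, hρ, hρr⟩ := nhds_basis_closedBall.mem_iff.1
    ((hf.isOpenMap _ isOpen_ball).mem_nhds ⟨x, mem_ball_self hr, rfl⟩)
  let e := hf.toOpenPartialHomeomorph f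
  have hef : ∀ a, e.symm (f a) = a := fun a => e.left_inv (by simp [e])
  have hmaps : ∀ y ∈ closedBall (f x) ρ, e.symm y ∈ ball x r := by
    intro y hy
    obtain ⟨a, ha, rfl⟩ := hρr hy
    rwa [hef]
  have hcont : ContinuousOn e.symm (closedBall (f x) ρ) := e.symm.continuousOn.mono fun y hy => by
    obtain ⟨a, ha, rfl⟩ := hρr hy
    simp [e]
  have hunif := (isCompact_closedBall (f x) ρ).uniformContinuousOn_of_continuous hcont
  rw [Metric.uniformContinuousOn_iff] at hunif
  refine ⟨ρ, hρ, fun ε hε => ?_⟩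
  obtain ⟨ε', hε', hunif⟩ := hunif ε hε
  obtain ⟨δ, hδ, h⟩ := exists_bd_eq_of_mem_ball (p := p) (f x) hρ hε'
  refine ⟨δ, hδ, fun z hz hz0 => ?_⟩
  obtain ⟨c, hc, hcz⟩ := h m (map f (m + 1) z)
    (map_mem_fineChains (fun y hy => (hfd y x).trans_lt hy)
      (fun a _ b _ hab => (hfd a b).trans_lt hab) hz) (by rw [bd_map, hz0, map_zero])
  refine ⟨map e.symm (m + 2) c, map_mem_fineChains (fun y hy => hmaps y (ball_subset_closedBall hy))
    (fun a ha b hb hab => hunif a (ball_subset_closedBall ha) b (ball_subset_closedBall hb) hab) hc,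
    ?_⟩
  rw [bd_map, hcz, map_map]
  exact map_eq_self (S := Set.univ) (fun a _ => hef a) ((mem_supported _ _).2 fun _ _ _ => trivial)

end Contraction

end

open Topology

section Charts

theorem locallyPathConnectedSpace_fixedPoints_of_isOpenEmbedding {p : ℕ} [Fact p.Prime]
    {G E : Type} [Group G] [Finite G] (hG : IsPGroup p G) [t : TopologicalSpace E] [MulAction G E]
    (hcont : ∀ g : G, Continuous fun x : E => g • x) {n : ℕ} {f : E → Fin n → ℝ}
    (hf : IsOpenEmbedding f) : LocallyPathConnectedSpace (MulAction.fixedPoints G E) := by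
  have := Fintype.ofFinite G
  let Φ : E → G → Fin n → ℝ := fun y g => f (g • y)
  have hΦ : IsEmbedding Φ := by
    refine IsEmbedding.of_comp (continuous_pi fun g => hf.continuous.comp (hcont g))
      (continuous_apply (1 : G)) ?_
    have : (fun u : G → Fin n → ℝ => u 1) ∘ Φ = f := funext fun y => by simp [Φ]
    rw [this]
    exact hf.isEmbedding
  let _ : MetricSpace E := hΦ.comapMetricSpace Φ
  have hdist : ∀ y z : E, dist y z = dist (Φ y) (Φ z) := fun _ _ => rfl
  have hle : ∀ (g : G) (y z : E), dist (g • y) (g • z) ≤ dist y z := by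
    intro g y z
    rw [hdist, hdist, dist_pi_le_iff dist_nonneg]
    intro h
    have := dist_le_pi_dist (Φ y) (Φ z) (h * g)
    simpa only [Φ, mul_smul] using this
  have hiso : ∀ g : G, Isometry fun y : E => g • y := fun g =>
    Isometry.of_dist_eq fun y z => le_antisymm (hle g y z)
      (by simpa using hle g⁻¹ (g • y) (g • z))
  have hlc : LocallyCompactSpace E := hf.locallyCompactSpace
  have hfd : ∀ y z, dist (f y) (f z) ≤ dist y z := fun y z => by
    simpa [hdist, Φ] using dist_le_pi_dist (Φ y) (Φ z) 1
  have hX : HasSmallLabels E :=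
    HasSmallLabels.of_isometry (f := Φ) (fun _ _ => rfl) hasSmallLabels_real.pi.pi
  obtain ⟨k, hk⟩ := IsPGroup.iff_card.1 hG
  have hL := HomologicallyLC.fixedPoints_of_card hX k hk hiso
    (homologicallyLC_of_isOpenEmbedding hf hfd)
  have hclosed : IsClosed (MulAction.fixedPoints G E) := by
    have : MulAction.fixedPoints G E = ⋂ g : G, {y | g • y = y} := by
      ext y
      simp [MulAction.mem_fixedPoints]
    rw [this]
    exact isClosed_iInter fun g => isClosed_eq (hcont g) continuous_id
  have := hclosed.locallyCompactSpace
  exact locallyPathConnectedSpace_of_chainJoined fun x r hr => (hL x).chainJoined hr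

end Charts

lemma locallyPathConnectedSpace_of_exists_isOpenEmbedding {X : Type*} [TopologicalSpace X]
    (h : ∀ x : X, ∃ (Y : Type) (_ : TopologicalSpace Y) (j : Y → X), LocallyPathConnectedSpace Y ∧
      IsOpenEmbedding j ∧ x ∈ Set.range j) : LocallyPathConnectedSpace X := by
  rw [locallyPathConnectedSpace_iff_pathComponentIn_mem_nhds]
  intro x u hu hxu
  obtain ⟨Y, _, j, hY, hj, y, rfl⟩ := h x
  have h1 := locallyPathConnectedSpace_iff_pathComponentIn_mem_nhds.1 hY y (j ⁻¹' u)
    (hu.preimage hj.continuous) hxu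
  refine Filter.mem_of_superset (hj.isOpenMap.image_mem_nhds h1) ?_
  rintro _ ⟨z, hz, rfl⟩
  exact (JoinedIn.map hz hj.continuous).mono (Set.image_preimage_subset _ _)

/-- If a finite `p`-group `G` acts continuously on a topological manifold `M`,
then the fixed-point set `M^G` is locally path-connected in the subspace topology. -/
theorem fixedPoints_locPathConnected (p : ℕ) (hp : p.Prime)
    (G M : Type) [Group G] [Finite G] (hpG : IsPGroup p G)
    [TopologicalSpace M] (hM : IsTopologicalManifold M)
    [MulAction G M] (hcont : ∀ g : G, Continuous (fun x : M => g • x)) :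
    LocPathConnectedSpace (MulAction.fixedPoints G M) := by
  have : Fact p.Prime := ⟨hp⟩
  refine locallyPathConnectedSpace_of_exists_isOpenEmbedding fun x => ?_
  obtain ⟨n, U, V, hU, hxU, hV, ⟨h⟩⟩ := hM.2.2 x
  let E : SubMulAction G M :=
    { carrier := ⋂ g : G, (fun y => g • y) ⁻¹' U
      smul_mem' := fun a y hy => Set.mem_iInter.2 fun g => by
        have := Set.mem_iInter.1 hy (g * a)
        rwa [Set.mem_preimage, mul_smul] at this }
  have hE : IsOpen (E : Set M) := isOpen_iInter_of_finite fun g => hU.preimage (hcont g)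
  have hEU : (E : Set M) ⊆ U := fun y hy => by simpa using Set.mem_iInter.1 hy 1
  have hxE : (x : M) ∈ E := Set.mem_iInter.2 fun g => by
    rw [Set.mem_preimage, x.2 g]
    exact hxU
  have hf : IsOpenEmbedding fun y : E => (h ⟨y, hEU y.2⟩ : Fin n → ℝ) :=
    hV.isOpenEmbedding_subtypeVal.comp (h.isOpenEmbedding.comp
      (IsOpenEmbedding.of_comp _ hU.isOpenEmbedding_subtypeVal hE.isOpenEmbedding_subtypeVal))
  have hEcont : ∀ g : G, Continuous fun y : E => g • y := fun g =>
    ((hcont g).comp continuous_subtype_val).subtype_mk _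
  let j : MulAction.fixedPoints G E → MulAction.fixedPoints G M := fun y =>
    ⟨y, fun g => congrArg Subtype.val (y.2 g)⟩
  refine ⟨MulAction.fixedPoints G E, inferInstance, j,
    locallyPathConnectedSpace_fixedPoints_of_isOpenEmbedding hpG hEcont hf, ?_,
    ⟨⟨x, hxE⟩, fun g => Subtype.ext (x.2 g)⟩, rfl⟩
  have hj : Continuous j := (continuous_subtype_val.comp continuous_subtype_val).subtype_mk _
  refine ⟨IsEmbedding.of_comp hj continuous_subtype_val
    (IsEmbedding.subtypeVal.comp IsEmbedding.subtypeVal :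
      IsEmbedding fun y : MulAction.fixedPoints G E => ((y : E) : M)), ?_⟩
  have hrange : Set.range j = Subtype.val ⁻¹' (E : Set M) := by
    ext y
    constructor
    · rintro ⟨z, rfl⟩
      exact z.1.2
    · exact fun hy => ⟨⟨⟨y, hy⟩, fun g => Subtype.ext (y.2 g)⟩, rfl⟩
  rw [hrange]
  exact hE.preimage continuous_subtype_val
end
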